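/- arXiv:math/0410603 — 6 statements merged into one kernel-verified Lean document; each statement's English description precedes it below -/
import Mathlib

section
/- For every natural number n ≥ 4 there exist a natural number N, a simplicial complex K in ℝ^N (in the sense of Mathlib's Geometry.SimplicialComplex: a collection of affine simplices closed under taking faces and intersecting along common faces), and a bijection e from the set of diagonals of the convex n-gon to the set of vertices of K, such that a nonempty finite set S of diagonals is noncrossing if and only if the image of S under e is the vertex set of a simplex of K, and such that the underlying space of K (the union of its simplices) is homeomorphic to the Euclidean sphere of dimension n − 4. -/
/-- A diagonal of the convex `n`-gon with vertices `0, 1, …, n-1` in cyclic order: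
a pair `(a, b)` with `a < b`, `b < n`, `b - a ≥ 2`, and `(a, b) ≠ (0, n-1)`. -/
def Diag (n : ℕ) : Set (ℕ × ℕ) :=
  {p | p.1 < p.2 ∧ p.2 < n ∧ 2 ≤ p.2 - p.1 ∧ p ≠ (0, n - 1)}

/-- Two diagonals `(a,b)` and `(c,d)` cross if `a < c < b < d` or `c < a < d < b`. -/
def Crosses (p q : ℕ × ℕ) : Prop :=
  (p.1 < q.1 ∧ q.1 < p.2 ∧ p.2 < q.2) ∨ (q.1 < p.1 ∧ p.1 < q.2 ∧ q.2 < p.2)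

/-- A set of diagonals is noncrossing if no two of its elements cross. -/
def Noncrossing (S : Set (ℕ × ℕ)) : Prop :=
  ∀ p ∈ S, ∀ q ∈ S, ¬ Crosses p q

/-! ### Realizing an abstract complex on the standard basis -/

section Realization

variable {ι : Type*} [DecidableEq ι]

lemma single_one_injective : Function.Injective fun i : ι => (Pi.single i (1 : ℝ) : ι → ℝ) :=
  (Pi.linearIndependent_single_one ι ℝ).injective

variable [Fintype ι]

/-- The geometric realization of an abstract simplicial complex on a finite vertex type `ι`, with
the vertices placed at the standard basis vectors of `ι → ℝ`. -/
noncomputable def stdRealization (A : PreAbstractSimplicialComplex ι) :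
    Geometry.SimplicialComplex ℝ (ι → ℝ) :=
  Geometry.SimplicialComplex.ofAffineIndependent (A.map fun i => Pi.single i (1 : ℝ)) (by
    refine (Pi.linearIndependent_single_one ι ℝ).affineIndependent.range.mono fun x hx => ?_
    simp only [Set.mem_iUnion, Finset.mem_coe] at hx
    obtain ⟨_, ⟨_, _, rfl⟩, hx⟩ := hx
    grind)

lemma image_single_mem_faces_stdRealization (A : PreAbstractSimplicialComplex ι) (t : Finset ι) :
    t.image (fun i => (Pi.single i (1 : ℝ) : ι → ℝ)) ∈ (stdRealization A).faces ↔
      t ∈ A.faces := by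
  constructor
  · rintro ⟨u, hu, h⟩
    rwa [← Finset.image_injective single_one_injective h]
  · exact fun h => ⟨t, h, rfl⟩

lemma mem_convexHull_image_single (t : Finset ι) (w : ι → ℝ) :
    w ∈ convexHull ℝ (t.image (fun i => (Pi.single i (1 : ℝ) : ι → ℝ)) : Set (ι → ℝ)) ↔
      w ∈ stdSimplex ℝ ι ∧ ∀ i ∉ t, w i = 0 := by
  constructor
  · intro hw
    have hconv : Convex ℝ {v : ι → ℝ | v ∈ stdSimplex ℝ ι ∧ ∀ i ∉ t, v i = 0} := by
      refine (convex_stdSimplex ℝ ι).inter fun x hx y hy a b _ _ _ i hi => ?_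
      simp [hx i hi, hy i hi]
    refine convexHull_min ?_ hconv hw
    intro v hv
    simp only [Finset.coe_image, Set.mem_image, Finset.mem_coe] at hv
    obtain ⟨i, hi, rfl⟩ := hv
    refine ⟨single_mem_stdSimplex ℝ i, fun j hj => ?_⟩
    exact Pi.single_eq_of_ne (by rintro rfl; exact hj hi) _
  · rintro ⟨⟨hnonneg, hsum⟩, hsupp⟩
    have hw : w = ∑ i ∈ t, w i • (Pi.single i (1 : ℝ) : ι → ℝ) := by
      ext j
      by_cases hj : j ∈ t <;> simp [Finset.sum_apply, Pi.single_apply, hj, hsupp]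
    rw [hw]
    refine (convex_convexHull ℝ _).sum_mem (fun i _ => hnonneg i) ?_ fun i hi =>
      subset_convexHull ℝ _ (Finset.mem_coe.2 (Finset.mem_image_of_mem _ hi))
    rw [← hsum]
    exact Finset.sum_subset (Finset.subset_univ t) fun i _ hi => hsupp i hi

lemma mem_space_stdRealization (A : PreAbstractSimplicialComplex ι) (w : ι → ℝ) :
    w ∈ (stdRealization A).space ↔
      w ∈ stdSimplex ℝ ι ∧ Finset.univ.filter (fun i => w i ≠ 0) ∈ A.faces := by
  rw [Geometry.SimplicialComplex.mem_space_iff]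
  constructor
  · rintro ⟨_, ⟨t, ht, rfl⟩, hw⟩
    obtain ⟨hw, hsupp⟩ := (mem_convexHull_image_single t w).1 hw
    refine ⟨hw, (A.isRelLowerSet_faces ht).2 (fun i hi => ?_) ?_⟩
    · by_contra h
      exact (Finset.mem_filter.1 hi).2 (hsupp i h)
    · by_contra h
      have hzero : ∀ i, w i = 0 := by simpa [Finset.filter_eq_empty_iff] using h
      simpa [hzero] using hw.2
  · rintro ⟨hw, hface⟩
    refine ⟨_, (image_single_mem_faces_stdRealization A _).2 hface,
      (mem_convexHull_image_single _ w).2 ⟨hw, fun i hi => ?_⟩⟩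
    simpa using hi

end Realization

/-! ### Links of complete fans are spheres -/

/-- If a linear map sends a closed cone of nonnegative vectors bijectively onto `E`, then the
section of the cone by the standard simplex is homeomorphic to the unit sphere of `E`. -/
lemma nonempty_homeomorph_sphere_of_bijOn_cone {ι E : Type*} [Fintype ι] [NormedAddCommGroup E]
    [NormedSpace ℝ E] {C : Set (ι → ℝ)} (hclosed : IsClosed C) (hnonneg : ∀ w ∈ C, ∀ i, 0 ≤ w i)
    (hsmul : ∀ w ∈ C, ∀ c : ℝ, 0 ≤ c → c • w ∈ C) (f : (ι → ℝ) →ₗ[ℝ] E)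
    (hf : Set.BijOn f C Set.univ) :
    Nonempty ((stdSimplex ℝ ι ∩ C : Set (ι → ℝ)) ≃ₜ Metric.sphere (0 : E) 1) := by
  have hzero : (0 : ι → ℝ) ∈ C := by
    obtain ⟨w, hw, -⟩ := hf.surjOn (Set.mem_univ 0)
    simpa using hsmul w hw 0 le_rfl
  have hne : ∀ w ∈ C, w ≠ 0 → f w ≠ 0 := fun w hw h hfw =>
    h (hf.injOn hw hzero (by rw [hfw, map_zero]))
  have hsimplex : ∀ w ∈ stdSimplex ℝ ι, w ≠ 0 := by
    rintro w hw rfl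
    simpa using hw.2
  have hpos : ∀ w : (stdSimplex ℝ ι ∩ C : Set (ι → ℝ)), 0 < ‖f w‖ := fun w =>
    norm_pos_iff.2 (hne w w.2.2 (hsimplex w w.2.1))
  let g : (stdSimplex ℝ ι ∩ C : Set (ι → ℝ)) → Metric.sphere (0 : E) 1 := fun w =>
    ⟨‖f w‖⁻¹ • f w, by
      rw [mem_sphere_zero_iff_norm, norm_smul, norm_inv, norm_norm,
        inv_mul_cancel₀ (hpos w).ne']⟩
  have hg : Continuous g := by
    refine Continuous.subtype_mk ?_ _
    have hfc : Continuous fun w : (stdSimplex ℝ ι ∩ C : Set (ι → ℝ)) => f w :=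
      f.continuous_of_finiteDimensional.comp continuous_subtype_val
    exact (hfc.norm.inv₀ fun w => (hpos w).ne').smul hfc
  have hinj : Function.Injective g := by
    intro v w h
    have h' : ‖f v‖⁻¹ • f v = ‖f w‖⁻¹ • f w := congrArg Subtype.val h
    rw [← map_smul, ← map_smul] at h'
    have h₁ := hf.injOn (hsmul v v.2.2 _ (by positivity)) (hsmul w w.2.2 _ (by positivity)) h'
    have h₂ := congrArg (fun u : ι → ℝ => ∑ i, u i) h₁
    simp only [Pi.smul_apply, smul_eq_mul, ← Finset.mul_sum, v.2.1.2, w.2.1.2, mul_one] at h₂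
    rw [h₂] at h₁
    exact Subtype.ext (smul_right_injective _ (inv_pos.2 (hpos w)).ne' h₁)
  have hsurj : Function.Surjective g := by
    rintro ⟨u, hu⟩
    obtain ⟨w, hw, rfl⟩ := hf.surjOn (Set.mem_univ u)
    rw [mem_sphere_zero_iff_norm] at hu
    have hsum : 0 < ∑ i, w i := by
      refine (Finset.sum_nonneg fun i _ => hnonneg w hw i).lt_of_ne fun h => ?_
      have h0 : w = 0 := funext fun i =>
        (Finset.sum_eq_zero_iff_of_nonneg fun i _ => hnonneg w hw i).1 h.symm i
          (Finset.mem_univ i)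
      simp [h0] at hu
    refine ⟨⟨(∑ i, w i)⁻¹ • w, ⟨fun i => ?_, ?_⟩, hsmul w hw _ (by positivity)⟩, ?_⟩
    · exact mul_nonneg (by positivity) (hnonneg w hw i)
    · simp only [Pi.smul_apply, smul_eq_mul, ← Finset.mul_sum]
      exact inv_mul_cancel₀ hsum.ne'
    · refine Subtype.ext ?_
      simp only [g, map_smul, norm_smul, hu, norm_inv, Real.norm_eq_abs, abs_of_pos hsum, mul_one,
        inv_inv, smul_smul]
      rw [mul_inv_cancel₀ hsum.ne', one_smul]
  have : CompactSpace (stdSimplex ℝ ι ∩ C : Set (ι → ℝ)) :=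
    isCompact_iff_compactSpace.1 ((isCompact_stdSimplex ℝ ι).inter_right hclosed)
  exact ⟨Continuous.homeoOfEquivCompactToT2 (f := Equiv.ofBijective g ⟨hinj, hsurj⟩) hg⟩

/-! ### Weighted noncrossing families of diagonals -/

section Weights

variable {ι : Type*} (d : ι → ℕ × ℕ)

/-- The nonnegative weights on a family of diagonals whose support is noncrossing. -/
def noncrossingCone : Set (ι → ℝ) :=
  {w | (∀ p, 0 ≤ w p) ∧ ∀ p q, Crosses (d p) (d q) → w p = 0 ∨ w q = 0}

lemma isClosed_noncrossingCone : IsClosed (noncrossingCone d) := by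
  simp only [noncrossingCone, Set.ofPred_and, Set.ofPred_forall]
  refine (isClosed_iInter fun p => isClosed_le continuous_const (continuous_apply p)).inter
    (isClosed_iInter fun p => isClosed_iInter fun q => isClosed_iInter fun _ => ?_)
  exact (isClosed_eq (continuous_apply p) continuous_const).union
    (isClosed_eq (continuous_apply q) continuous_const)

lemma smul_mem_noncrossingCone {w : ι → ℝ} (hw : w ∈ noncrossingCone d) {c : ℝ} (hc : 0 ≤ c) :
    c • w ∈ noncrossingCone d := by
  refine ⟨fun p => mul_nonneg hc (hw.1 p), fun p q hpq => ?_⟩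
  exact (hw.2 p q hpq).imp (fun h => by simp [h]) (fun h => by simp [h])

variable {d} in
/-- In a noncrossing family, the diagonals lying strictly inside `[a, b]` leave some integer
strictly between `a` and `b` uncovered. -/
lemma exists_uncovered (T : Finset ι)
    (hT : ∀ p ∈ T, ∀ q ∈ T, ¬ Crosses (d p) (d q)) (hlt : ∀ p, (d p).1 + 2 ≤ (d p).2)
    {a b : ℕ} (hab : a + 2 ≤ b) :
    ∃ i, a < i ∧ i < b ∧ ∀ p ∈ T, a ≤ (d p).1 → (d p).2 ≤ b → d p ≠ (a, b) →
      ¬ ((d p).1 < i ∧ i < (d p).2) := by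
  classical
  set U := T.filter fun p => a ≤ (d p).1 ∧ (d p).2 ≤ b ∧ d p ≠ (a, b) with hU
  rcases U.eq_empty_or_nonempty with h | h
  · refine ⟨a + 1, by omega, by omega, fun p hp h₁ h₂ h₃ => ?_⟩
    have : p ∈ U := by simp [hU, hp, h₁, h₂, h₃]
    simp [h] at this
  · obtain ⟨q, hq, hmax⟩ := U.exists_max_image (fun p => (d p).2 - (d p).1) h
    simp only [hU, Finset.mem_filter] at hq hmax
    obtain ⟨hqT, hq₁, hq₂, hq₃⟩ := hq
    have hq₃' : ¬ ((d q).1 = a ∧ (d q).2 = b) := fun h => hq₃ (Prod.ext h.1 h.2)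
    have hqlt := hlt q
    have key : ∀ i, (i = (d q).1 ∨ i = (d q).2) → ∀ p ∈ T, a ≤ (d p).1 → (d p).2 ≤ b →
        d p ≠ (a, b) → ¬ ((d p).1 < i ∧ i < (d p).2) := by
      intro i hi p hp h₁ h₂ h₃ hcov
      have hle := hmax p ⟨hp, h₁, h₂, h₃⟩
      have hcross := hT p hp q hqT
      unfold Crosses at hcross
      omega
    by_cases hb : (d q).2 < b
    · exact ⟨(d q).2, by omega, hb, key _ (Or.inr rfl)⟩
    · exact ⟨(d q).1, by omega, by omega, key _ (Or.inl rfl)⟩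

variable [Fintype ι]

/-- The total weight of the diagonals `(a, b)` with `a < j < b`. -/
def height (w : ι → ℝ) (j : ℕ) : ℝ :=
  ∑ p, if (d p).1 < j ∧ j < (d p).2 then w p else 0

variable {d}

lemma height_nonneg {w : ι → ℝ} (hw : w ∈ noncrossingCone d) (j : ℕ) : 0 ≤ height d w j :=
  Finset.sum_nonneg fun p _ => by split_ifs <;> simp [hw.1 p]

lemma height_endpoint_lt {w : ι → ℝ} (hw : w ∈ noncrossingCone d) {p : ι} (hp : w p ≠ 0) {i : ℕ}
    (h₁ : (d p).1 < i) (h₂ : i < (d p).2) :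
    height d w (d p).1 < height d w i ∧ height d w (d p).2 < height d w i := by
  have hpos : 0 < w p := (hw.1 p).lt_of_ne' hp
  have key : ∀ j, (j = (d p).1 ∨ j = (d p).2) → height d w j < height d w i := by
    intro j hj
    refine Finset.sum_lt_sum (fun q _ => ?_) ⟨p, Finset.mem_univ p, ?_⟩
    · have hq := hw.1 q
      have hpq := (hw.2 p q · |>.resolve_left hp)
      unfold Crosses at hpq
      split_ifs with hA hB hB
      · rfl
      · exact (hpq (by omega)).le
      · exact hq
      · rfl
    · rw [if_neg (by omega), if_pos ⟨h₁, h₂⟩]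
      exact hpos
  exact ⟨key _ (Or.inl rfl), key _ (Or.inr rfl)⟩

lemma eq_of_height_eq (hd : Function.Injective d) (hlt : ∀ p, (d p).1 + 2 ≤ (d p).2)
    {v w : ι → ℝ} (hv : v ∈ noncrossingCone d) (hw : w ∈ noncrossingCone d)
    (h : ∀ j, height d v j = height d w j) : v = w := by
  classical
  have hmixed : ∀ p q, v p ≠ 0 → w q ≠ 0 →
      ¬ Crosses (d p) (d q) ∧ ¬ Crosses (d q) (d p) := by
    intro p q hp hq
    have hvp := fun i => height_endpoint_lt hv hp (i := i)
    have hwq := fun i => height_endpoint_lt hw hq (i := i)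
    refine ⟨?_, ?_⟩ <;> rintro (⟨h₁, h₂, h₃⟩ | ⟨h₁, h₂, h₃⟩)
    · exact absurd ((hvp _ h₁ h₂).2.trans_eq (h _)) (by
        have := (hwq _ h₂ h₃).1; rw [h]; exact this.not_gt)
    · exact absurd ((hvp _ h₂ h₃).1.trans_eq (h _)) (by
        have := (hwq _ h₁ h₂).2; rw [h]; exact this.not_gt)
    · exact absurd ((hvp _ h₂ h₃).1.trans_eq (h _)) (by
        have := (hwq _ h₁ h₂).2; rw [h]; exact this.not_gt)
    · exact absurd ((hvp _ h₁ h₂).2.trans_eq (h _)) (by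
        have := (hwq _ h₂ h₃).1; rw [h]; exact this.not_gt)
  set T := Finset.univ.filter fun p => v p ≠ 0 ∨ w p ≠ 0 with hTdef
  have hT : ∀ p ∈ T, ∀ q ∈ T, ¬ Crosses (d p) (d q) := by
    intro p hp q hq hc
    simp only [hTdef, Finset.mem_filter, Finset.mem_univ, true_and] at hp hq
    have := hv.2 p q hc
    have := hw.2 p q hc
    have := hmixed p q
    have := hmixed q p
    tauto
  by_contra hne
  obtain ⟨p, hp, hmax⟩ := (Finset.univ.filter fun p => v p ≠ w p).exists_max_image
    (fun p => (d p).2 - (d p).1) (by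
      obtain ⟨p, hp⟩ := Function.ne_iff.1 hne
      exact ⟨p, by simpa using hp⟩)
  simp only [Finset.mem_filter, Finset.mem_univ, true_and] at hp hmax
  have hmemT : ∀ q, v q ≠ w q → q ∈ T := by
    intro q hq
    simp only [hTdef, Finset.mem_filter, Finset.mem_univ, true_and]
    by_contra hcon
    push Not at hcon
    exact hq (hcon.1.trans hcon.2.symm)
  obtain ⟨i, hi₁, hi₂, hi⟩ := exists_uncovered T hT hlt (hlt p)
  have hdiff : ∑ q, (if (d q).1 < i ∧ i < (d q).2 then v q - w q else 0) = v p - w p := by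
    rw [Finset.sum_eq_single p, if_pos ⟨hi₁, hi₂⟩]
    · intro q _ hqp
      split_ifs with hcov
      · by_contra hq
        have hq' : v q ≠ w q := fun h => hq (sub_eq_zero.2 h)
        have hle := hmax q hq'
        have hc := hT p (hmemT p hp) q (hmemT q hq')
        have hdne : d q ≠ d p := fun h => hqp (hd h)
        have hdne' : ¬ ((d q).1 = (d p).1 ∧ (d q).2 = (d p).2) := fun h =>
          hdne (Prod.ext h.1 h.2)
        have hnot := fun h₁ h₂ => hi q (hmemT q hq') h₁ h₂ hdne
        unfold Crosses at hc
        have := hlt q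
        have := hlt p
        by_cases h₁ : (d p).1 ≤ (d q).1
        · by_cases h₂ : (d q).2 ≤ (d p).2
          · exact hnot h₁ h₂ hcov
          · omega
        · omega
      · rfl
    · simp
  have hzero : ∑ q, (if (d q).1 < i ∧ i < (d q).2 then v q - w q else 0) = 0 := by
    have := h i
    unfold height at this
    rw [← sub_eq_zero, ← Finset.sum_sub_distrib] at this
    refine (Finset.sum_congr rfl fun q _ => ?_).trans this
    split_ifs <;> simp
  exact hp (sub_eq_zero.1 (hdiff.symm.trans hzero))

variable {n : ℕ}

lemma exists_height_eq_zero (hn : 4 ≤ n) (hrange : Set.range d = Diag n) {w : ι → ℝ}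
    (hw : w ∈ noncrossingCone d) : ∃ j, 0 < j ∧ j < n - 1 ∧ height d w j = 0 := by
  classical
  have hdiag : ∀ p, d p ∈ Diag n := fun p => hrange ▸ Set.mem_range_self p
  obtain ⟨j, hj₀, hj₁, hj⟩ := exists_uncovered (d := d) (a := 0) (b := n - 1)
    (Finset.univ.filter fun p => w p ≠ 0)
    (by
      intro p hp q hq hc
      have := hw.2 p q hc
      simp only [Finset.mem_filter, Finset.mem_univ, true_and] at hp hq
      tauto)
    (fun p => by have := hdiag p; simp only [Diag, Set.mem_ofPred_eq] at this; omega) (by omega)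
  refine ⟨j, hj₀, hj₁, Finset.sum_eq_zero fun p _ => ?_⟩
  split_ifs with hcov
  · by_contra hp
    have h := hdiag p
    exact hj p (by simpa using hp) (Nat.zero_le _) (by have := h.2.1; omega) h.2.2.2 hcov
  · rfl

/-- The levels `s` at which the open interval `(a, b)` is a connected component of the strict
superlevel set `{i | s < y i}`. -/
def componentLevels (y : ℕ → ℝ) (p : ℕ × ℕ) : Set ℝ :=
  {s | y p.1 ≤ s ∧ y p.2 ≤ s ∧ ∀ i, p.1 < i → i < p.2 → s < y i}

lemma measurableSet_componentLevels (y : ℕ → ℝ) (p : ℕ × ℕ) :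
    MeasurableSet (componentLevels y p) := by
  refine Set.OrdConnected.measurableSet ⟨fun s hs t ht r hr => ?_⟩
  exact ⟨hs.1.trans hr.1, hs.2.1.trans hr.1, fun i h₁ h₂ => hr.2.trans_lt (ht.2.2 i h₁ h₂)⟩

lemma iUnion_componentLevels (hrange : Set.range d = Diag n) {y : ℕ → ℝ}
    (hy : ∀ j, 0 ≤ y j) (hy₀ : y 0 = 0) (hy₁ : y (n - 1) = 0)
    (hmin : ∃ j, 0 < j ∧ j < n - 1 ∧ y j = 0) {j : ℕ} (hj : j < n - 1) :
    ⋃ p ∈ Finset.univ.filter (fun p => (d p).1 < j ∧ j < (d p).2), componentLevels y (d p) =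
      Set.Ico 0 (y j) := by
  classical
  ext s
  simp only [Finset.mem_filter, Finset.mem_univ, true_and, Set.mem_iUnion, exists_prop,
    Set.mem_Ico]
  constructor
  · rintro ⟨p, ⟨h₁, h₂⟩, hs⟩
    exact ⟨(hy _).trans hs.1, hs.2.2 j h₁ h₂⟩
  · rintro ⟨hs₀, hs₁⟩
    set a := Nat.findGreatest (fun i => y i ≤ s) j with ha
    have hya : y a ≤ s := Nat.findGreatest_spec (P := fun i => y i ≤ s) (Nat.zero_le j)
      (by simpa [hy₀] using hs₀)
    have haj : a < j := by
      refine (Nat.findGreatest_le j).lt_of_ne fun h => ?_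
      rw [← ha] at h
      rw [h] at hya
      exact hs₁.not_ge hya
    have hex : ∃ i, j ≤ i ∧ y i ≤ s := ⟨n - 1, hj.le, by simpa [hy₁] using hs₀⟩
    set b := Nat.find hex with hb
    obtain ⟨hjb, hyb⟩ : j ≤ b ∧ y b ≤ s := Nat.find_spec hex
    have hjb' : j < b := by
      refine hjb.lt_of_ne fun h => ?_
      rw [← h] at hyb
      exact hs₁.not_ge hyb
    have hbn : b ≤ n - 1 := Nat.find_min' hex ⟨hj.le, by simpa [hy₁] using hs₀⟩
    have hbetween : ∀ i, a < i → i < b → s < y i := by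
      intro i h₁ h₂
      by_contra! hi
      rcases le_total j i with h | h
      · exact Nat.find_min hex h₂ ⟨h, hi⟩
      · exact Nat.findGreatest_is_greatest (P := fun i => y i ≤ s) h₁ h hi
    have hdiag : (a, b) ∈ Diag n := by
      refine ⟨haj.trans hjb', show b < n by omega, show 2 ≤ b - a by omega, fun h => ?_⟩
      obtain ⟨h₁, h₂⟩ := Prod.mk.inj h
      obtain ⟨k, hk₀, hk₁, hk⟩ := hmin
      have := hbetween k (by omega) (by omega)
      linarith
    rw [← hrange] at hdiag
    obtain ⟨p, hp⟩ := hdiag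
    exact ⟨p, by rw [hp]; exact ⟨haj, hjb'⟩, by rw [hp]; exact ⟨hya, hyb, hbetween⟩⟩

/-- Layer-cake decomposition: a nonnegative function with a zero is the height function of the
weights counting for how long each interval is a component of a superlevel set. -/
lemma exists_weight_of_height (hd : Function.Injective d) (hrange : Set.range d = Diag n)
    {y : ℕ → ℝ} (hy : ∀ j, 0 ≤ y j) (hy₀ : y 0 = 0) (hy₁ : y (n - 1) = 0)
    (hmin : ∃ j, 0 < j ∧ j < n - 1 ∧ y j = 0) :
    ∃ w ∈ noncrossingCone d, ∀ j, j < n - 1 → height d w j = y j := by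
  classical
  refine ⟨fun p => MeasureTheory.volume.real (componentLevels y (d p)), ⟨fun p => by positivity,
    fun p q hpq => ?_⟩, fun j hj => ?_⟩
  · by_contra! h
    obtain ⟨s, hs⟩ : (componentLevels y (d p)).Nonempty :=
      MeasureTheory.nonempty_of_measureReal_ne_zero h.1
    obtain ⟨t, ht⟩ : (componentLevels y (d q)).Nonempty :=
      MeasureTheory.nonempty_of_measureReal_ne_zero h.2
    rcases hpq with ⟨h₁, h₂, h₃⟩ | ⟨h₁, h₂, h₃⟩
    · linarith [hs.2.2 _ h₁ h₂, ht.2.2 _ h₂ h₃, hs.2.1, ht.1]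
    · linarith [ht.2.2 _ h₁ h₂, hs.2.2 _ h₂ h₃, ht.2.1, hs.1]
  · have hunion := iUnion_componentLevels hrange hy hy₀ hy₁ hmin hj
    have hfinite : ∀ p ∈ Finset.univ.filter (fun p => (d p).1 < j ∧ j < (d p).2),
        MeasureTheory.volume (componentLevels y (d p)) ≠ ⊤ := by
      intro p hp
      refine ((MeasureTheory.measure_mono ?_).trans_lt
        (measure_Ico_lt_top (a := (0 : ℝ)) (b := y j))).ne
      rw [← hunion]
      exact Set.subset_biUnion_of_mem (u := fun p => componentLevels y (d p)) hp
    unfold height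
    rw [← Finset.sum_filter, ← MeasureTheory.measureReal_biUnion_finset (h := hfinite), hunion]
    · simp [Real.volume_real_Ico_of_le (hy j)]
    · intro p hp q hq hpq
      simp only [Finset.coe_filter, Finset.mem_univ, true_and, Set.mem_ofPred_eq] at hp hq
      refine Set.disjoint_left.2 fun s hs ht => hpq (hd (Prod.ext ?_ ?_))
      · rcases lt_trichotomy (d p).1 (d q).1 with h | h | h
        · exact absurd (hs.2.2 _ h (by omega)) ht.1.not_gt
        · exact h
        · exact absurd (ht.2.2 _ h (by omega)) hs.1.not_gt
      · rcases lt_trichotomy (d p).2 (d q).2 with h | h | h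
        · exact absurd (ht.2.2 _ (by omega) h) hs.2.1.not_gt
        · exact h
        · exact absurd (hs.2.2 _ (by omega) h) ht.2.1.not_gt
    · exact fun p _ => measurableSet_componentLevels y (d p)

variable (d n) in
/-- The linear map recording the heights at `1, …, n - 3` relative to the height at `n - 2`. -/
noncomputable def relativeHeight : (ι → ℝ) →ₗ[ℝ] EuclideanSpace ℝ (Fin (n - 3)) where
  toFun w := WithLp.toLp 2 fun k => height d w (k + 1) - height d w (n - 2)
  map_add' v w := by
    ext k
    simp only [height, Pi.add_apply, PiLp.add_apply, ← Finset.sum_sub_distrib,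
      ← Finset.sum_add_distrib]
    exact Finset.sum_congr rfl fun p _ => by split_ifs <;> ring
  map_smul' c w := by
    ext k
    simp only [height, Pi.smul_apply, PiLp.smul_apply, smul_eq_mul, RingHom.id_apply,
      ← Finset.sum_sub_distrib, Finset.mul_sum]
    exact Finset.sum_congr rfl fun p _ => by split_ifs <;> ring

lemma bijOn_relativeHeight (hn : 4 ≤ n) (hd : Function.Injective d)
    (hrange : Set.range d = Diag n) :
    Set.BijOn (relativeHeight d n) (noncrossingCone d) Set.univ := by
  have hdiag : ∀ p, d p ∈ Diag n := fun p => hrange ▸ Set.mem_range_self p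
  refine ⟨Set.mapsTo_univ _ _, fun v hv w hw h => ?_, fun z _ => ?_⟩
  · have hshift : ∀ j, 0 < j → j < n - 1 →
        height d v j - height d v (n - 2) = height d w j - height d w (n - 2) := by
      intro j h₀ h₁
      by_cases hj : j = n - 2
      · simp [hj]
      · have := congrArg (fun z : EuclideanSpace ℝ (Fin (n - 3)) => z ⟨j - 1, by omega⟩) h
        simpa [relativeHeight, Nat.sub_add_cancel h₀] using this
    have hconst : height d v (n - 2) = height d w (n - 2) := by
      obtain ⟨j, hj₀, hj₁, hj⟩ := exists_height_eq_zero hn hrange hv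
      obtain ⟨k, hk₀, hk₁, hk⟩ := exists_height_eq_zero hn hrange hw
      linarith [hshift j hj₀ hj₁, hshift k hk₀ hk₁, height_nonneg hw j, height_nonneg hv k]
    refine eq_of_height_eq hd (fun p => ?_) hv hw fun j => ?_
    · have := (hdiag p).2.2.1
      omega
    · by_cases hj : 0 < j ∧ j < n - 1
      · linarith [hshift j hj.1 hj.2]
      · refine Finset.sum_congr rfl fun p _ => ?_
        have := (hdiag p).2.1
        rw [if_neg (by omega), if_neg (by omega)]
  · let x : ℕ → ℝ := fun j => if h : j - 1 < n - 3 then z ⟨j - 1, h⟩ else 0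
    obtain ⟨m, hm, hmin⟩ := (Finset.Ioo 0 (n - 1)).exists_min_image x ⟨1, by simp; omega⟩
    simp only [Finset.mem_Ioo] at hm hmin
    obtain ⟨w, hw, hheight⟩ := exists_weight_of_height (n := n) hd hrange
      (y := fun j => if 0 < j ∧ j < n - 1 then x j - x m else 0)
      (fun j => by
        split_ifs with h
        · exact sub_nonneg.2 (hmin j h)
        · rfl)
      (by simp) (by simp) ⟨m, hm.1, hm.2, by simp⟩
    refine ⟨w, hw, ?_⟩
    ext k
    have hk := k.2
    simp only [relativeHeight, LinearMap.coe_mk, AddHom.coe_mk]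
    rw [hheight _ (by omega), hheight _ (by omega), if_pos (by omega), if_pos (by omega)]
    have hx : x (n - 2) = 0 := dif_neg (by omega)
    have hxk : x (k + 1) = z k := by
      simp [x]
    rw [hx, hxk]
    ring

end Weights

/-! ### The arc complex -/

lemma finite_diag (n : ℕ) : (Diag n).Finite := by
  refine ((Set.finite_Iio n).prod (Set.finite_Iio n)).subset fun p hp => ?_
  exact ⟨hp.1.trans hp.2.1, hp.2.1⟩

/-- The abstract complex of nonempty noncrossing sets of members of a family of diagonals. -/
def noncrossingComplex {ι : Type*} (d : ι → ℕ × ℕ) : PreAbstractSimplicialComplex ι where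
  faces := {t | t.Nonempty ∧ Noncrossing (d '' t)}
  isRelLowerSet_faces := by
    rintro t ⟨ht, hc⟩
    refine ⟨ht, fun u hu hne => ⟨hne, fun p hp q hq => ?_⟩⟩
    exact hc p (Set.image_mono (Finset.coe_subset.2 hu) hp) q
      (Set.image_mono (Finset.coe_subset.2 hu) hq)

lemma space_stdRealization_noncrossingComplex {ι : Type*} [Fintype ι] [DecidableEq ι]
    (d : ι → ℕ × ℕ) :
    (stdRealization (noncrossingComplex d)).space = stdSimplex ℝ ι ∩ noncrossingCone d := by
  ext w
  rw [mem_space_stdRealization]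
  refine and_congr_right fun hw => ⟨fun h => ⟨hw.1, fun p q hpq => ?_⟩, fun h => ⟨?_, ?_⟩⟩
  · by_contra! hne
    exact h.2 _ ⟨p, by simpa using hne.1, rfl⟩ _ ⟨q, by simpa using hne.2, rfl⟩ hpq
  · by_contra hempty
    have hzero : ∀ i, w i = 0 := by simpa [Finset.filter_eq_empty_iff] using hempty
    simpa [hzero] using hw.2
  · rintro _ ⟨p, hp, rfl⟩ _ ⟨q, hq, rfl⟩ hpq
    simp only [Finset.coe_filter, Finset.mem_univ, true_and, Set.mem_ofPred_eq] at hp hq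
    exact (h.2 p q hpq).elim hp hq

/-- The Classical Fact: the arc complex of the convex `n`-gon, the simplicial complex
whose simplices are the nonempty noncrossing sets of diagonals, can be realized as a
geometric simplicial complex whose underlying space is homeomorphic to the sphere of
dimension `n - 4`. -/
theorem arcComplex_polygon_spherical (n : ℕ) (hn : 4 ≤ n) :
    ∃ (N : ℕ) (K : Geometry.SimplicialComplex ℝ (Fin N → ℝ))
      (e : Diag n ≃ K.vertices),
      (∀ S : Finset (Diag n), S.Nonempty →
        (Noncrossing (Subtype.val '' (S : Set (Diag n))) ↔
          S.image (fun d => ((e d : K.vertices) : Fin N → ℝ)) ∈ K.faces)) ∧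
      Nonempty (K.space ≃ₜ Metric.sphere (0 : EuclideanSpace ℝ (Fin (n - 3))) 1) := by
  classical
  have := (finite_diag n).fintype
  let E : Diag n ≃ Fin (Fintype.card (Diag n)) := Fintype.equivFin _
  let d : Fin (Fintype.card (Diag n)) → ℕ × ℕ := fun i => (E.symm i : ℕ × ℕ)
  have hd : Function.Injective d := Subtype.val_injective.comp E.symm.injective
  have hrange : Set.range d = Diag n := by
    rw [show d = Subtype.val ∘ E.symm from rfl, E.symm.surjective.range_comp, Subtype.range_coe]
  let K := stdRealization (noncrossingComplex d)
  have hface : ∀ S : Finset (Diag n), S.Nonempty →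
      (Noncrossing (Subtype.val '' (S : Set (Diag n))) ↔
        S.image (fun p => (Pi.single (E p) (1 : ℝ) : Fin (Fintype.card (Diag n)) → ℝ)) ∈
          K.faces) := by
    intro S hS
    have himage : S.image (fun p => (Pi.single (E p) (1 : ℝ) : Fin (Fintype.card (Diag n)) → ℝ)) =
        (S.image E).image fun i => Pi.single i (1 : ℝ) := by
      rw [Finset.image_image]
      rfl
    have hdE : d '' (S.image E : Finset _) = Subtype.val '' (S : Set (Diag n)) := by
      rw [Finset.coe_image, Set.image_image]
      simp [d]
    rw [himage, image_single_mem_faces_stdRealization, ← hdE]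
    exact ⟨fun h => ⟨hS.image E, h⟩, fun h => h.2⟩
  have hvertex : ∀ p : Diag n, (Pi.single (E p) (1 : ℝ) : Fin (Fintype.card (Diag n)) → ℝ) ∈
      K.vertices := by
    intro p
    have h := (hface {p} (Finset.singleton_nonempty p)).1 (by
      simp only [Finset.coe_singleton, Set.image_singleton, Noncrossing, Set.mem_singleton_iff]
      rintro _ rfl _ rfl (h | h) <;> omega)
    simpa [Geometry.SimplicialComplex.mem_vertices] using h
  let e : Diag n ≃ K.vertices := Equiv.ofBijective (fun p => ⟨_, hvertex p⟩) (by
    refine ⟨fun p q h => E.injective (single_one_injective (congrArg Subtype.val h)), ?_⟩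
    rintro ⟨x, t, ht, hx⟩
    have hmem : x ∈ t.image fun i => (Pi.single i (1 : ℝ) : Fin (Fintype.card (Diag n)) → ℝ) := by
      have : x ∈ ({x} : Finset (Fin (Fintype.card (Diag n)) → ℝ)) := Finset.mem_singleton_self x
      rwa [← hx] at this
    obtain ⟨i, -, rfl⟩ := Finset.mem_image.1 hmem
    exact ⟨E.symm i, Subtype.ext (by simp)⟩)
  refine ⟨_, K, e, fun S hS => ?_, ?_⟩
  · convert hface S hS using 4
    rfl
  · rw [show K.space = _ from space_stdRealization_noncrossingComplex d]
    exact nonempty_homeomorph_sphere_of_bijOn_cone (isClosed_noncrossingCone d)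
      (fun w hw => hw.1) (fun w hw c hc => smul_mem_noncrossingCone d hw hc) (relativeHeight d n)
      (bijOn_relativeHeight hn hd hrange)
end

section
/- Let m₁, m₂, m₃ be natural numbers. There exist natural numbers a, b, c, l₁, l₂, l₃ satisfying m₁ = a + b + 2l₁, m₂ = a + c + 2l₂, m₃ = b + c + 2l₃, such that at most one of l₁, l₂, l₃ is nonzero, and such that l₁ ≠ 0 implies c = 0, l₂ ≠ 0 implies b = 0, and l₃ ≠ 0 implies a = 0, if and only if m₁ + m₂ + m₃ is even. Moreover, when such a tuple (a, b, c, l₁, l₂, l₃) exists it is unique. -/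
/-- The combinatorial core of the Dehn–Thurston Lemma for the pair of pants:
`(a, b, c, l₁, l₂, l₃)` records the numbers of arcs joining the pairs of boundary
components and the numbers of loops based at each boundary component, realizing
the intersection numbers `(m₁, m₂, m₃)`.  Disjointness forces at most one `lᵢ` to
be nonzero and a loop at `∂ᵢ` to exclude the arcs joining the other two boundary
components. -/
def IsPantsArcData (m₁ m₂ m₃ : ℕ) (x : ℕ × ℕ × ℕ × ℕ × ℕ × ℕ) : Prop :=
  match x with
  | (a, b, c, l₁, l₂, l₃) =>
      m₁ = a + b + 2 * l₁ ∧ m₂ = a + c + 2 * l₂ ∧ m₃ = b + c + 2 * l₃ ∧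
      (l₁ = 0 ∨ l₂ = 0) ∧ (l₁ = 0 ∨ l₃ = 0) ∧ (l₂ = 0 ∨ l₃ = 0) ∧
      (l₁ ≠ 0 → c = 0) ∧ (l₂ ≠ 0 → b = 0) ∧ (l₃ ≠ 0 → a = 0)

/-- The loop numbers are half the defects in the triangle inequalities
(with truncated subtraction). -/
theorem IsPantsArcData.loops_eq {m₁ m₂ m₃ a b c l₁ l₂ l₃ : ℕ}
    (h : IsPantsArcData m₁ m₂ m₃ (a, b, c, l₁, l₂, l₃)) :
    l₁ = (m₁ - m₂ - m₃) / 2 ∧ l₂ = (m₂ - m₁ - m₃) / 2 ∧ l₃ = (m₃ - m₁ - m₂) / 2 := by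
  simp only [IsPantsArcData] at h
  omega

/-- The Dehn–Thurston Lemma for the pair of pants, combinatorial form: a triple
`(m₁, m₂, m₃)` of intersection numbers is realized by a family of disjointly
embedded essential arcs iff `m₁ + m₂ + m₃` is even, and the realizing data is
unique. -/
theorem dehn_thurston_pants_nat (m₁ m₂ m₃ : ℕ) :
    ((∃ x : ℕ × ℕ × ℕ × ℕ × ℕ × ℕ, IsPantsArcData m₁ m₂ m₃ x) ↔ Even (m₁ + m₂ + m₃)) ∧
    (∀ x y : ℕ × ℕ × ℕ × ℕ × ℕ × ℕ,
      IsPantsArcData m₁ m₂ m₃ x → IsPantsArcData m₁ m₂ m₃ y → x = y) := by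
  refine ⟨⟨?_, fun h => ?_⟩, ?_⟩
  · rintro ⟨⟨a, b, c, l₁, l₂, l₃⟩, h₁, h₂, h₃, -⟩
    exact ⟨a + b + c + l₁ + l₂ + l₃, by omega⟩
  · rw [Nat.even_iff] at h
    by_cases h₁ : m₂ + m₃ < m₁
    · refine ⟨(m₂, m₃, 0, (m₁ - m₂ - m₃) / 2, 0, 0), ?_, ?_, ?_, ?_, ?_, ?_, ?_, ?_, ?_⟩ <;> omega
    by_cases h₂ : m₁ + m₃ < m₂
    · refine ⟨(m₁, 0, m₃, 0, (m₂ - m₁ - m₃) / 2, 0), ?_, ?_, ?_, ?_, ?_, ?_, ?_, ?_, ?_⟩ <;> omega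
    by_cases h₃ : m₁ + m₂ < m₃
    · refine ⟨(0, m₁, m₂, 0, 0, (m₃ - m₁ - m₂) / 2), ?_, ?_, ?_, ?_, ?_, ?_, ?_, ?_, ?_⟩ <;> omega
    refine ⟨((m₁ + m₂ - m₃) / 2, (m₁ + m₃ - m₂) / 2, (m₂ + m₃ - m₁) / 2, 0, 0, 0),
      ?_, ?_, ?_, ?_, ?_, ?_, ?_, ?_, ?_⟩ <;> omega
  · rintro ⟨a, b, c, l₁, l₂, l₃⟩ ⟨a', b', c', l₁', l₂', l₃'⟩ hx hy
    obtain ⟨hx₁, hx₂, hx₃⟩ := hx.loops_eq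
    obtain ⟨hy₁, hy₂, hy₃⟩ := hy.loops_eq
    obtain ⟨_, _, _, -⟩ := hx
    obtain ⟨_, _, _, -⟩ := hy
    obtain rfl : l₁ = l₁' := hx₁.trans hy₁.symm
    obtain rfl : l₂ = l₂' := hx₂.trans hy₂.symm
    obtain rfl : l₃ = l₃' := hx₃.trans hy₃.symm
    clear hx₁ hx₂ hx₃ hy₁ hy₂ hy₃
    simp only [Prod.mk.injEq, and_true]
    omega
end

section
/- Let a group G act on a type V, and extend the action to finite subsets of V elementwise. Let K be a collection of finite subsets of V that is G-invariant (g · s ∈ K whenever s ∈ K and g ∈ G) and rigid: whenever g ∈ G and s ∈ K satisfy g · s = s as a set, g fixes every element of s. Let c be a finite collection of nonempty members of K that is totally ordered by inclusion, let c₁ and c₂ be subsets of c, and let g ∈ G be such that the elementwise image of c₁ under the action of g equals c₂. Then c₁ = c₂, and g fixes every element of V belonging to some member of c₁. -/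
/-- The elementwise action of a group element on a finite subset of `V`. -/
def smulFinset {G V : Type*} [Group G] [MulAction G V] [DecidableEq V]
    (g : G) (s : Finset V) : Finset V :=
  s.image (fun v => g • v)

theorem card_smulFinset {G V : Type*} [Group G] [MulAction G V] [DecidableEq V]
    (g : G) (s : Finset V) : (smulFinset g s).card = s.card :=
  Finset.card_image_of_injective s (MulAction.injective g)

/-- In a chain of finite sets, members of equal cardinality coincide. -/
theorem IsChain.eq_of_card_eq {V : Type*} {c : Set (Finset V)} (hc : IsChain (· ⊆ ·) c)
    {s t : Finset V} (hs : s ∈ c) (ht : t ∈ c) (h : s.card = t.card) : s = t :=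
  (hc.total hs ht).elim (fun hst => Finset.eq_of_subset_of_card_le hst h.ge)
    (fun hts => (Finset.eq_of_subset_of_card_le hts h.le).symm)

/-- Combinatorial content of the first assertion of Lemma 6: if a group `G` acts on
a simplicial complex (encoded as a `G`-invariant collection `K` of finite vertex
sets) rigidly — any `g` stabilizing a simplex setwise fixes it pointwise — then no
two faces of a simplex of the first barycentric subdivision (a chain `c` of
simplices ordered by inclusion) are identified in the quotient: if `g` carries a
subset `c₁` of `c` onto a subset `c₂` of `c`, then `c₁ = c₂` and `g` fixes every
vertex occurring in `c₁`. -/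
theorem barycentric_subdivision_regular {G V : Type*} [Group G] [MulAction G V]
    [DecidableEq V] (K : Set (Finset V))
    (hinv : ∀ g : G, ∀ s ∈ K, smulFinset g s ∈ K)
    (hrigid : ∀ g : G, ∀ s ∈ K, smulFinset g s = s → ∀ v ∈ s, g • v = v)
    (c : Finset (Finset V)) (hcK : ↑c ⊆ K) (hcne : ∀ s ∈ c, s.Nonempty)
    (hchain : IsChain (· ⊆ ·) (↑c : Set (Finset V)))
    (c₁ c₂ : Finset (Finset V)) (h₁ : c₁ ⊆ c) (h₂ : c₂ ⊆ c)
    (g : G) (hg : c₁.image (smulFinset g) = c₂) :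
    c₁ = c₂ ∧ ∀ s ∈ c₁, ∀ v ∈ s, g • v = v := by
  have hfix : ∀ s ∈ c₁, smulFinset g s = s := fun s hs =>
    hchain.eq_of_card_eq (h₂ (hg ▸ Finset.mem_image_of_mem _ hs)) (h₁ hs) (card_smulFinset g s)
  refine ⟨?_, fun s hs => hrigid g s (hcK (h₁ hs)) (hfix s hs)⟩
  rw [← hg, Finset.image_congr (g := id) hfix, Finset.image_id]
end

section
/- Let a group G act on a type V, extended elementwise to finite subsets, to finite collections of finite subsets, and to finite collections of such collections. Let K be a G-invariant collection of finite subsets of V that is rigid: whenever g ∈ G and s ∈ K satisfy g · s = s as a set, g fixes every element of s. Call a finite set of nonempty members of K totally ordered by inclusion a chain, and call a finite set of chains totally ordered by inclusion a 2-chain. Let σ and τ be 2-chains, let c₁ and c₂ be nonempty subsets of σ, and let g₁, g₂ ∈ G be such that the elementwise image of c₁ under g₁ and the elementwise image of c₂ under g₂ are both contained in τ. If the inclusion-greatest element of c₁ is contained in the inclusion-greatest element of c₂, then g₂⁻¹g₁ fixes every element of V belonging to some member of some member of c₁; in particular the elementwise images of c₁ under g₁ and under g₂ coincide, and the union of g₁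 · c₁ and g₂ · c₂ equals the elementwise image of c₁ ∪ c₂ under g₂. -/
/-- The elementwise action on a finite collection of finite subsets of `V`. -/
def smulFinset2 {G V : Type*} [Group G] [MulAction G V] [DecidableEq V]
    (g : G) (c : Finset (Finset V)) : Finset (Finset V) :=
  c.image (smulFinset g)

/-- The elementwise action on a finite collection of finite collections of finite
subsets of `V`. -/
def smulFinset3 {G V : Type*} [Group G] [MulAction G V] [DecidableEq V]
    (g : G) (σ : Finset (Finset (Finset V))) : Finset (Finset (Finset V)) :=
  σ.image (smulFinset2 g)

/-- A chain: a finite set of nonempty members of `K` totally ordered by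
inclusion. -/
def IsKChain {V : Type*} (K : Set (Finset V)) (c : Finset (Finset V)) : Prop :=
  ↑c ⊆ K ∧ (∀ s ∈ c, s.Nonempty) ∧ IsChain (· ⊆ ·) (↑c : Set (Finset V))

/-- A 2-chain: a finite set of chains totally ordered by inclusion. -/
def Is2Chain {V : Type*} (K : Set (Finset V)) (σ : Finset (Finset (Finset V))) : Prop :=
  (∀ c ∈ σ, IsKChain K c) ∧ IsChain (· ⊆ ·) (↑σ : Set (Finset (Finset V)))

theorem smulFinset_mul {G V : Type*} [Group G] [MulAction G V] [DecidableEq V]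
    (g h : G) (s : Finset V) : smulFinset (g * h) s = smulFinset g (smulFinset h s) := by
  simp [smulFinset, Finset.image_image, Function.comp_def, mul_smul]

theorem smulFinset_one {G V : Type*} [Group G] [MulAction G V] [DecidableEq V]
    (s : Finset V) : smulFinset (1 : G) s = s := by
  simp [smulFinset]

/-- Two translates of the same finite set that belong to a common chain are equal. -/
theorem smulFinset_eq_of_mem_chain {G V : Type*} [Group G] [MulAction G V] [DecidableEq V]
    {D : Finset (Finset V)} (hD : IsChain (· ⊆ ·) (↑D : Set (Finset V))) {g h : G}
    {s : Finset V} (hg : smulFinset g s ∈ D) (hh : smulFinset h s ∈ D) :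
    smulFinset g s = smulFinset h s := by
  rcases hD.total hg hh with hsub | hsub
  · exact Finset.eq_of_subset_of_card_le hsub (by simp only [card_smulFinset, le_refl])
  · exact (Finset.eq_of_subset_of_card_le hsub (by simp only [card_smulFinset, le_refl])).symm

/-- If translates of two collections belong to a common 2-chain, then the two group elements
agree on every set that lies in both collections. -/
theorem smulFinset_eq_of_mem_2chain {G V : Type*} [Group G] [MulAction G V] [DecidableEq V]
    {K : Set (Finset V)} {τ : Finset (Finset (Finset V))} (hτ : Is2Chain K τ) {g h : G}
    {M N : Finset (Finset V)} (hM : smulFinset2 g M ∈ τ) (hN : smulFinset2 h N ∈ τ)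
    {s : Finset V} (hsM : s ∈ M) (hsN : s ∈ N) : smulFinset g s = smulFinset h s := by
  have hgs : smulFinset g s ∈ smulFinset2 g M := Finset.mem_image_of_mem _ hsM
  have hhs : smulFinset h s ∈ smulFinset2 h N := Finset.mem_image_of_mem _ hsN
  rcases hτ.2.total hM hN with hsub | hsub
  · exact smulFinset_eq_of_mem_chain (hτ.1 _ hN).2.2 (hsub hgs) hhs
  · exact smulFinset_eq_of_mem_chain (hτ.1 _ hM).2.2 hgs (hsub hhs)

/-- Combinatorial content of the second assertion of Lemma 6: for a rigid action of
`G` on a simplicial complex (encoded as the `G`-invariant collection `K` of finite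
vertex sets), the second barycentric subdivision, whose simplices are the 2-chains,
descends to a simplicial complex on the quotient.  If `g₁, g₂` carry subsets
`c₁, c₂` of a 2-chain `σ` into a common 2-chain `τ`, and the greatest element `M₁`
of `c₁` is contained in the greatest element `M₂` of `c₂`, then `g₂⁻¹ g₁` fixes
every vertex occurring in `c₁`; in particular the images of `c₁` under `g₁` and
`g₂` coincide and `g₁ · c₁ ∪ g₂ · c₂ = g₂ · (c₁ ∪ c₂)`. -/
theorem second_barycentric_subdivision_simplicial {G V : Type*} [Group G]
    [MulAction G V] [DecidableEq V] (K : Set (Finset V))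
    (hinv : ∀ g : G, ∀ s ∈ K, smulFinset g s ∈ K)
    (hrigid : ∀ g : G, ∀ s ∈ K, smulFinset g s = s → ∀ v ∈ s, g • v = v)
    (σ τ : Finset (Finset (Finset V))) (hσ : Is2Chain K σ) (hτ : Is2Chain K τ)
    (c₁ c₂ : Finset (Finset (Finset V))) (h₁ : c₁ ⊆ σ) (h₂ : c₂ ⊆ σ)
    (h₁ne : c₁.Nonempty) (h₂ne : c₂.Nonempty)
    (g₁ g₂ : G) (hg₁ : smulFinset3 g₁ c₁ ⊆ τ) (hg₂ : smulFinset3 g₂ c₂ ⊆ τ)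
    (M₁ M₂ : Finset (Finset V)) (hM₁ : M₁ ∈ c₁) (hM₁max : ∀ c ∈ c₁, c ⊆ M₁)
    (hM₂ : M₂ ∈ c₂) (hM₂max : ∀ c ∈ c₂, c ⊆ M₂) (hMM : M₁ ⊆ M₂) :
    (∀ c ∈ c₁, ∀ s ∈ c, ∀ v ∈ s, (g₂⁻¹ * g₁) • v = v) ∧
    smulFinset3 g₁ c₁ = smulFinset3 g₂ c₁ ∧
    smulFinset3 g₁ c₁ ∪ smulFinset3 g₂ c₂ = smulFinset3 g₂ (c₁ ∪ c₂) := by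
  have heq : ∀ s ∈ M₁, smulFinset g₁ s = smulFinset g₂ s := fun s hs =>
    smulFinset_eq_of_mem_2chain hτ (hg₁ (Finset.mem_image_of_mem _ hM₁))
      (hg₂ (Finset.mem_image_of_mem _ hM₂)) hs (hMM hs)
  have himage : smulFinset3 g₁ c₁ = smulFinset3 g₂ c₁ :=
    Finset.image_congr fun c hc => Finset.image_congr fun s hs => heq s (hM₁max c hc hs)
  refine ⟨fun c hc s hs => ?_, himage, ?_⟩
  · refine hrigid _ s ((hσ.1 c (h₁ hc)).1 hs) ?_
    rw [smulFinset_mul, heq s (hM₁max c hc hs), ← smulFinset_mul, inv_mul_cancel,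
      smulFinset_one]
  · rw [himage]
    exact (Finset.image_union c₁ c₂).symm
end

section
/- Let I be the set of ordered pairs (i,j) of distinct elements of {1,2,3}, and for (i,j) ∈ I let k denote the unique element of {1,2,3} \ {i,j}. Let C₀, C₁, C₂, C₃ be free ℤ-modules with bases, respectively: {A₁, A₂, A₃, B₁, B₂, B₃}; {C_{ij} : (i,j) ∈ I} ∪ {D_{ij} : (i,j) ∈ I} ∪ {E₁, E₂, E₃} ∪ {F₁, F₂, F₃}; {G_{ij}, H_{ij}, I_{ij}, J_{ij} : (i,j) ∈ I}; and {K_{ij}, L_{ij} : (i,j) ∈ I}. Define ℤ-linear maps ∂₁ : C₁ → C₀, ∂₂ : C₂ → C₁, ∂₃ : C₃ → C₂ on basis elements by ∂₁C_{ij} = A_i − A_j, ∂₁D_{ij} = A_j − B_k, ∂₁E_k = A_k − B_k, ∂₁F_k = B_k − A_k, ∂₂G_{ij} = C_{ij} − D_{ji} + D_{ij}, ∂₂H_{ij} = D_{ij} − C_{jk} + F_k, ∂₂I_{ij} = D_{ij} − E_k + C_{kj}, ∂₂J_{ij} = C_{ij} − C_{ik} + C_{jk}, ∂₃K_{ij}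 = G_{ij} − H_{ij} + H_{ji} − J_{ij}, and ∂₃L_{ij} = I_{ij} − G_{ij} + J_{ki} − I_{ji}. Then ∂₁ ∘ ∂₂ = 0 and ∂₂ ∘ ∂₃ = 0, so these maps form a chain complex, and its homology is that of the 3-sphere: the cokernel of ∂₁ is isomorphic to ℤ, the kernel of ∂₁ equals the image of ∂₂, the kernel of ∂₂ equals the image of ∂₃, and the kernel of ∂₃ is isomorphic to ℤ. -/
/-- Ordered pairs `(i,j)` of distinct elements of the three-element set,
encoded as `ZMod 3`. -/
def DPair : Type := {p : ZMod 3 × ZMod 3 // p.1 ≠ p.2}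

/-- The third element `k = k(i,j)`, the unique element distinct from both `i`
and `j`; in `ZMod 3` it is `-(i+j)`. -/
def kk (p : DPair) : ZMod 3 := -(p.val.1 + p.val.2)

lemma left_ne_kk : ∀ (i j : ZMod 3), i ≠ j → i ≠ -(i + j) := by decide

lemma right_ne_kk : ∀ (i j : ZMod 3), i ≠ j → j ≠ -(i + j) := by decide

/-- `C₀`: free `ℤ`-module on `A₁, A₂, A₃` (left summand) and `B₁, B₂, B₃`
(right summand). -/
abbrev C0 : Type := (ZMod 3 ⊕ ZMod 3) →₀ ℤ

/-- `C₁`: free `ℤ`-module on `C_{ij}`, `D_{ij}` (`(i,j) ∈ I`), `E₁, E₂, E₃`,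
`F₁, F₂, F₃`, in that order of summands. -/
abbrev C1 : Type := (DPair ⊕ DPair ⊕ ZMod 3 ⊕ ZMod 3) →₀ ℤ

/-- `C₂`: free `ℤ`-module on `G_{ij}`, `H_{ij}`, `I_{ij}`, `J_{ij}` for
`(i,j) ∈ I`, in that order of summands. -/
abbrev C2 : Type := (DPair ⊕ DPair ⊕ DPair ⊕ DPair) →₀ ℤ

/-- `C₃`: free `ℤ`-module on `K_{ij}`, `L_{ij}` for `(i,j) ∈ I`. -/
abbrev C3 : Type := (DPair ⊕ DPair) →₀ ℤ

/-- Basis elements. -/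
noncomputable def bA (i : ZMod 3) : C0 := Finsupp.single (Sum.inl i) 1
noncomputable def bB (i : ZMod 3) : C0 := Finsupp.single (Sum.inr i) 1
noncomputable def bC (p : DPair) : C1 := Finsupp.single (Sum.inl p) 1
noncomputable def bD (p : DPair) : C1 := Finsupp.single (Sum.inr (Sum.inl p)) 1
noncomputable def bE (k : ZMod 3) : C1 := Finsupp.single (Sum.inr (Sum.inr (Sum.inl k))) 1
noncomputable def bF (k : ZMod 3) : C1 := Finsupp.single (Sum.inr (Sum.inr (Sum.inr k))) 1
noncomputable def bG (p : DPair) : C2 := Finsupp.single (Sum.inl p) 1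
noncomputable def bH (p : DPair) : C2 := Finsupp.single (Sum.inr (Sum.inl p)) 1
noncomputable def bI (p : DPair) : C2 := Finsupp.single (Sum.inr (Sum.inr (Sum.inl p))) 1
noncomputable def bJ (p : DPair) : C2 := Finsupp.single (Sum.inr (Sum.inr (Sum.inr p))) 1
noncomputable def bK (p : DPair) : C3 := Finsupp.single (Sum.inl p) 1
noncomputable def bL (p : DPair) : C3 := Finsupp.single (Sum.inr p) 1

/-- The transpose pair `(j,i)`. -/
def DPair.swap (p : DPair) : DPair := ⟨(p.val.2, p.val.1), p.prop.symm⟩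

/-- The pair `(i, k)`. -/
def DPair.ik (p : DPair) : DPair :=
  ⟨(p.val.1, kk p), left_ne_kk p.val.1 p.val.2 p.prop⟩

/-- The pair `(j, k)`. -/
def DPair.jk (p : DPair) : DPair :=
  ⟨(p.val.2, kk p), right_ne_kk p.val.1 p.val.2 p.prop⟩

/-- The pair `(k, j)`. -/
def DPair.kj (p : DPair) : DPair := p.jk.swap

/-- The pair `(k, i)`. -/
def DPair.ki (p : DPair) : DPair := p.ik.swap

/-- `∂₁`: `∂C_{ij} = A_i − A_j`, `∂D_{ij} = A_j − B_k`, `∂E_k = A_k − B_k`,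
`∂F_k = B_k − A_k`. -/
noncomputable def del1 : C1 →ₗ[ℤ] C0 :=
  Finsupp.lift C0 ℤ _ fun x =>
    match x with
    | Sum.inl p => bA p.val.1 - bA p.val.2
    | Sum.inr (Sum.inl p) => bA p.val.2 - bB (kk p)
    | Sum.inr (Sum.inr (Sum.inl k)) => bA k - bB k
    | Sum.inr (Sum.inr (Sum.inr k)) => bB k - bA k

/-- `∂₂`: `∂G_{ij} = C_{ij} − D_{ji} + D_{ij}`, `∂H_{ij} = D_{ij} − C_{jk} + F_k`,
`∂I_{ij} = D_{ij} − E_k + C_{kj}`, `∂J_{ij} = C_{ij} − C_{ik} + C_{jk}`. -/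
noncomputable def del2 : C2 →ₗ[ℤ] C1 :=
  Finsupp.lift C1 ℤ _ fun x =>
    match x with
    | Sum.inl p => bC p - bD p.swap + bD p
    | Sum.inr (Sum.inl p) => bD p - bC p.jk + bF (kk p)
    | Sum.inr (Sum.inr (Sum.inl p)) => bD p - bE (kk p) + bC p.kj
    | Sum.inr (Sum.inr (Sum.inr p)) => bC p - bC p.ik + bC p.jk

/-- `∂₃`: `∂K_{ij} = G_{ij} − H_{ij} + H_{ji} − J_{ij}`,
`∂L_{ij} = I_{ij} − G_{ij} + J_{ki} − I_{ji}`. -/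
noncomputable def del3 : C3 →ₗ[ℤ] C2 :=
  Finsupp.lift C2 ℤ _ fun x =>
    match x with
    | Sum.inl p => bG p - bH p + bH p.swap - bJ p
    | Sum.inr p => bI p - bG p + bJ p.ki - bI p.swap

namespace DPair

instance : DecidableEq DPair :=
  inferInstanceAs (DecidableEq {p : ZMod 3 × ZMod 3 // p.1 ≠ p.2})

instance : Fintype DPair :=
  inferInstanceAs (Fintype {p : ZMod 3 × ZMod 3 // p.1 ≠ p.2})

/-- The pair `(i, j)`, with the inequality found by evaluation. -/
abbrev mk (i j : ZMod 3) (h : i ≠ j := by decide) : DPair := ⟨(i, j), h⟩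

lemma forall_iff {P : DPair → Prop} :
    (∀ p, P p) ↔
      P (mk 0 1) ∧ P (mk 0 2) ∧ P (mk 1 0) ∧ P (mk 1 2) ∧ P (mk 2 0) ∧ P (mk 2 1) := by
  refine ⟨fun h => ⟨h _, h _, h _, h _, h _, h _⟩, fun h p => ?_⟩
  have hp : p = mk 0 1 ∨ p = mk 0 2 ∨ p = mk 1 0 ∨ p = mk 1 2 ∨ p = mk 2 0 ∨ p = mk 2 1 := by
    revert p; decide
  rcases h with ⟨h₁, h₂, h₃, h₄, h₅, h₆⟩
  rcases hp with rfl | rfl | rfl | rfl | rfl | rfl <;> assumption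

lemma swap_mk (i j : ZMod 3) (h : i ≠ j) : swap (mk i j h) = mk j i h.symm := rfl

lemma kk_values :
    kk (mk 0 1) = 2 ∧ kk (mk 0 2) = 1 ∧ kk (mk 1 0) = 2 ∧
      kk (mk 1 2) = 0 ∧ kk (mk 2 0) = 1 ∧ kk (mk 2 1) = 0 := by
  decide

lemma ik_values :
    ik (mk 0 1) = mk 0 2 ∧ ik (mk 0 2) = mk 0 1 ∧ ik (mk 1 0) = mk 1 2 ∧
      ik (mk 1 2) = mk 1 0 ∧ ik (mk 2 0) = mk 2 1 ∧ ik (mk 2 1) = mk 2 0 := by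
  decide

lemma jk_values :
    jk (mk 0 1) = mk 1 2 ∧ jk (mk 0 2) = mk 2 1 ∧ jk (mk 1 0) = mk 0 2 ∧
      jk (mk 1 2) = mk 2 0 ∧ jk (mk 2 0) = mk 0 1 ∧ jk (mk 2 1) = mk 1 0 := by
  decide

lemma swap_eq_iff (p q : DPair) : p.swap = q ↔ p = q.swap := by
  revert p q; decide

lemma ki_inj (p q : DPair) : p.ki = q.ki ↔ p = q := by
  revert p q; decide

lemma kk_swap (p : DPair) : kk p.swap = kk p := by
  revert p; decide

lemma jk_swap (p : DPair) : p.swap.jk = p.ik := by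
  revert p; decide

lemma ik_ki (p : DPair) : p.ki.ik = p.kj := by
  revert p; decide

lemma jk_ki (p : DPair) : p.ki.jk = p := by
  revert p; decide

lemma kj_swap (p : DPair) : p.swap.kj = p.ki := by
  revert p; decide

end DPair

open DPair

lemma ZMod.forall_three {P : ZMod 3 → Prop} : (∀ k, P k) ↔ P 0 ∧ P 1 ∧ P 2 := by
  refine ⟨fun h => ⟨h _, h _, h _⟩, fun ⟨h₀, h₁, h₂⟩ k => ?_⟩
  fin_cases k <;> assumption

/-! ### Values on the bases -/

lemma del1_bC (p : DPair) : del1 (bC p) = bA p.val.1 - bA p.val.2 := by simp [del1, bC]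

lemma del1_bD (p : DPair) : del1 (bD p) = bA p.val.2 - bB (kk p) := by simp [del1, bD]

lemma del1_bE (k : ZMod 3) : del1 (bE k) = bA k - bB k := by simp [del1, bE]

lemma del1_bF (k : ZMod 3) : del1 (bF k) = bB k - bA k := by simp [del1, bF]

lemma del2_bG (p : DPair) : del2 (bG p) = bC p - bD p.swap + bD p := by simp [del2, bG]

lemma del2_bH (p : DPair) : del2 (bH p) = bD p - bC p.jk + bF (kk p) := by simp [del2, bH]

lemma del2_bI (p : DPair) : del2 (bI p) = bD p - bE (kk p) + bC p.kj := by simp [del2, bI]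

lemma del2_bJ (p : DPair) : del2 (bJ p) = bC p - bC p.ik + bC p.jk := by simp [del2, bJ]

lemma del3_bK (p : DPair) : del3 (bK p) = bG p - bH p + bH p.swap - bJ p := by simp [del3, bK]

lemma del3_bL (p : DPair) : del3 (bL p) = bI p - bG p + bJ p.ki - bI p.swap := by
  simp [del3, bL]

section Ext

variable {M : Type*} [AddCommGroup M]

lemma C0.hom_ext {f g : C0 →ₗ[ℤ] M} (hA : ∀ i, f (bA i) = g (bA i))
    (hB : ∀ i, f (bB i) = g (bB i)) : f = g := by
  refine Finsupp.lhom_ext' fun x => LinearMap.ext_ring ?_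
  rcases x with i | i
  exacts [hA i, hB i]

lemma C1.hom_ext {f g : C1 →ₗ[ℤ] M} (hC : ∀ p, f (bC p) = g (bC p))
    (hD : ∀ p, f (bD p) = g (bD p)) (hE : ∀ k, f (bE k) = g (bE k))
    (hF : ∀ k, f (bF k) = g (bF k)) : f = g := by
  refine Finsupp.lhom_ext' fun x => LinearMap.ext_ring ?_
  rcases x with p | p | k | k
  exacts [hC p, hD p, hE k, hF k]

lemma C2.hom_ext {f g : C2 →ₗ[ℤ] M} (hG : ∀ p, f (bG p) = g (bG p))
    (hH : ∀ p, f (bH p) = g (bH p)) (hI : ∀ p, f (bI p) = g (bI p))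
    (hJ : ∀ p, f (bJ p) = g (bJ p)) : f = g := by
  refine Finsupp.lhom_ext' fun x => LinearMap.ext_ring ?_
  rcases x with p | p | p | p
  exacts [hG p, hH p, hI p, hJ p]

lemma C3.hom_ext {f g : C3 →ₗ[ℤ] M} (hK : ∀ p, f (bK p) = g (bK p))
    (hL : ∀ p, f (bL p) = g (bL p)) : f = g := by
  refine Finsupp.lhom_ext' fun x => LinearMap.ext_ring ?_
  rcases x with p | p
  exacts [hK p, hL p]

end Ext

theorem del1_comp_del2 : del1 ∘ₗ del2 = 0 := by
  apply C2.hom_ext <;> intro p <;>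
    simp only [LinearMap.comp_apply, LinearMap.zero_apply, del2_bG, del2_bH, del2_bI, del2_bJ,
      map_add, map_sub, del1_bC, del1_bD, del1_bE, del1_bF, kk_swap] <;>
    simp only [DPair.swap, DPair.ik, DPair.jk, DPair.kj] <;> abel

theorem del2_comp_del3 : del2 ∘ₗ del3 = 0 := by
  apply C3.hom_ext <;> intro p <;>
    simp only [LinearMap.comp_apply, LinearMap.zero_apply, del3_bK, del3_bL, map_add, map_sub,
      del2_bG, del2_bH, del2_bI, del2_bJ, kk_swap, jk_swap, ik_ki, jk_ki, kj_swap] <;> abel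

/-! ### A contracting homotopy onto the vertex `A₀` -/

/-- The edge from `A_i` to the base vertex `A₀`, degenerate for `i = 0`. -/
noncomputable def baseEdge (i : ZMod 3) : C1 := if h : i = 0 then 0 else bC ⟨(i, 0), h⟩

/-- The contracting homotopy in degree `0`. -/
noncomputable def homotopy0 : C0 →ₗ[ℤ] C1 :=
  Finsupp.lift C1 ℤ _ fun x =>
    match x with
    | Sum.inl i => baseEdge i
    | Sum.inr k => bF k + baseEdge k

/-- A `2`-chain bounding the triangle formed by `C_{ij}` and the two base edges. -/
noncomputable def coneC (p : DPair) : C2 :=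
  if p.val.2 = 0 then 0 else if p.val.1 = 0 then bG p + bG p.swap else bJ p

/-- The contracting homotopy in degree `1`. -/
noncomputable def homotopy1 : C1 →ₗ[ℤ] C2 :=
  Finsupp.lift C2 ℤ _ fun x =>
    match x with
    | Sum.inl p => coneC p
    | Sum.inr (Sum.inl p) => bH p + coneC p.jk
    | Sum.inr (Sum.inr (Sum.inl k)) =>
      let q : DPair := ⟨(k + 1, k + 2), by simp; decide⟩
      bH q - bI q + bG q.jk + bG q.kj
    | Sum.inr (Sum.inr (Sum.inr _)) => 0

/-- A `3`-chain bounding `J_{ij}` minus the cone over its boundary. -/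
noncomputable def coneJ (p : DPair) : C3 :=
  if p.val.2 = 0 then bL p.jk + bL p.kj
  else if p.val.1 = 0 then
    bL p + bL p.swap + bK p.ik + bK p.ki + bL p.jk + bL p.kj + bK p.jk + bK p.kj
  else 0

/-- A `3`-chain bounding `I_{ij}` minus the cone over its boundary. -/
noncomputable def coneI (p : DPair) : C3 :=
  (if p.val.2 = p.val.1 + 1 then 0
    else bK p + bL p + bK p.ik + bK p.ki + bL p.jk + bL p.kj) +
  if p.val.1 = 0 then bK p.jk + bK p.kj else 0

/-- The contracting homotopy in degree `2`. -/
noncomputable def homotopy2 : C2 →ₗ[ℤ] C3 :=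
  Finsupp.lift C3 ℤ _ fun x =>
    match x with
    | Sum.inl p => bK p + coneJ p
    | Sum.inr (Sum.inl _) => 0
    | Sum.inr (Sum.inr (Sum.inl p)) => coneI p
    | Sum.inr (Sum.inr (Sum.inr p)) => coneJ p

lemma homotopy0_bA (i : ZMod 3) : homotopy0 (bA i) = baseEdge i := by simp [homotopy0, bA]

lemma homotopy0_bB (k : ZMod 3) : homotopy0 (bB k) = bF k + baseEdge k := by
  simp [homotopy0, bB]

lemma homotopy1_bC (p : DPair) : homotopy1 (bC p) = coneC p := by simp [homotopy1, bC]

lemma homotopy1_bD (p : DPair) : homotopy1 (bD p) = bH p + coneC p.jk := by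
  simp [homotopy1, bD]

lemma homotopy1_bE :
    homotopy1 (bE 0) = bH (mk 1 2) - bI (mk 1 2) + bG (mk 2 0) + bG (mk 0 2) ∧
      homotopy1 (bE 1) = bH (mk 2 0) - bI (mk 2 0) + bG (mk 0 1) + bG (mk 1 0) ∧
      homotopy1 (bE 2) = bH (mk 0 1) - bI (mk 0 1) + bG (mk 1 2) + bG (mk 2 1) := by
  simp only [homotopy1, bE, Finsupp.lift_apply, Finsupp.sum_single_index, zero_smul, one_smul]
  exact ⟨rfl, rfl, rfl⟩

lemma homotopy1_bF (k : ZMod 3) : homotopy1 (bF k) = 0 := by simp [homotopy1, bF]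

lemma homotopy2_bG (p : DPair) : homotopy2 (bG p) = bK p + coneJ p := by simp [homotopy2, bG]

lemma homotopy2_bH (p : DPair) : homotopy2 (bH p) = 0 := by simp [homotopy2, bH]

lemma homotopy2_bI (p : DPair) : homotopy2 (bI p) = coneI p := by simp [homotopy2, bI]

lemma homotopy2_bJ (p : DPair) : homotopy2 (bJ p) = coneJ p := by simp [homotopy2, bJ]

/-- The augmentation, sending every vertex to `1`. -/
noncomputable def augmentation : C0 →ₗ[ℤ] ℤ := Finsupp.lift ℤ ℤ _ fun _ => 1

lemma augmentation_bA (i : ZMod 3) : augmentation (bA i) = 1 := by simp [augmentation, bA]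

lemma augmentation_bB (i : ZMod 3) : augmentation (bB i) = 1 := by simp [augmentation, bB]

lemma augmentation_comp_del1 : augmentation ∘ₗ del1 = 0 := by
  apply C1.hom_ext <;> intro p <;>
    simp [del1_bC, del1_bD, del1_bE, del1_bF, augmentation_bA, augmentation_bB]

lemma del1_baseEdge (i : ZMod 3) : del1 (baseEdge i) = bA i - bA 0 := by
  unfold baseEdge
  split_ifs with h
  · simp [h]
  · exact del1_bC _

lemma homotopy_degree_zero :
    del1 ∘ₗ homotopy0 + augmentation.smulRight (bA 0) = LinearMap.id := by
  apply C0.hom_ext <;> intro i <;>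
    simp [homotopy0_bA, homotopy0_bB, augmentation_bA, augmentation_bB, del1_baseEdge, del1_bF]

lemma baseEdge_values :
    baseEdge 0 = 0 ∧ baseEdge 1 = bC (mk 1 0) ∧ baseEdge 2 = bC (mk 2 0) :=
  ⟨dif_pos rfl, dif_neg (by decide), dif_neg (by decide)⟩

lemma coneC_values :
    coneC (mk 0 1) = bG (mk 0 1) + bG (mk 1 0) ∧ coneC (mk 0 2) = bG (mk 0 2) + bG (mk 2 0) ∧
      coneC (mk 1 0) = 0 ∧ coneC (mk 1 2) = bJ (mk 1 2) ∧
      coneC (mk 2 0) = 0 ∧ coneC (mk 2 1) = bJ (mk 2 1) :=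
  ⟨rfl, rfl, rfl, rfl, rfl, rfl⟩

lemma homotopy_degree_one : del2 ∘ₗ homotopy1 + homotopy0 ∘ₗ del1 = LinearMap.id := by
  apply C1.hom_ext <;> (first | rw [DPair.forall_iff] | rw [ZMod.forall_three]) <;>
    simp only [LinearMap.add_apply, LinearMap.comp_apply, LinearMap.id_apply, homotopy1_bC,
      homotopy1_bD, homotopy1_bE, homotopy1_bF, coneC_values, del1_bC, del1_bD, del1_bE, del1_bF,
      map_add, map_sub, map_zero, homotopy0_bA, homotopy0_bB, baseEdge_values, del2_bG, del2_bH,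
      del2_bI, del2_bJ, kj, swap_mk, kk_values, ik_values, jk_values] <;>
    and_intros <;> abel

lemma coneJ_values :
    coneJ (mk 0 1) = bL (mk 0 1) + bL (mk 1 0) + bK (mk 0 2) + bK (mk 2 0) + bL (mk 1 2) +
        bL (mk 2 1) + bK (mk 1 2) + bK (mk 2 1) ∧
      coneJ (mk 0 2) = bL (mk 0 2) + bL (mk 2 0) + bK (mk 0 1) + bK (mk 1 0) + bL (mk 2 1) +
        bL (mk 1 2) + bK (mk 2 1) + bK (mk 1 2) ∧
      coneJ (mk 1 0) = bL (mk 0 2) + bL (mk 2 0) ∧ coneJ (mk 1 2) = 0 ∧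
      coneJ (mk 2 0) = bL (mk 0 1) + bL (mk 1 0) ∧ coneJ (mk 2 1) = 0 :=
  ⟨rfl, rfl, rfl, rfl, rfl, rfl⟩

lemma coneI_values :
    coneI (mk 0 1) = 0 + (bK (mk 1 2) + bK (mk 2 1)) ∧
      coneI (mk 0 2) = bK (mk 0 2) + bL (mk 0 2) + bK (mk 0 1) + bK (mk 1 0) + bL (mk 2 1) +
        bL (mk 1 2) + (bK (mk 2 1) + bK (mk 1 2)) ∧
      coneI (mk 1 0) = bK (mk 1 0) + bL (mk 1 0) + bK (mk 1 2) + bK (mk 2 1) + bL (mk 0 2) +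
        bL (mk 2 0) + 0 ∧
      coneI (mk 1 2) = 0 + 0 ∧ coneI (mk 2 0) = 0 + 0 ∧
      coneI (mk 2 1) = bK (mk 2 1) + bL (mk 2 1) + bK (mk 2 0) + bK (mk 0 2) + bL (mk 1 0) +
        bL (mk 0 1) + 0 :=
  ⟨rfl, rfl, rfl, rfl, rfl, rfl⟩

lemma homotopy_degree_two : del3 ∘ₗ homotopy2 + homotopy1 ∘ₗ del2 = LinearMap.id := by
  apply C2.hom_ext <;> rw [DPair.forall_iff] <;>
    simp only [LinearMap.add_apply, LinearMap.comp_apply, LinearMap.id_apply, homotopy2_bG,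
      homotopy2_bH, homotopy2_bI, homotopy2_bJ, coneI_values, coneJ_values, del2_bG, del2_bH,
      del2_bI, del2_bJ, map_add, map_sub, map_zero, homotopy1_bC, homotopy1_bD, homotopy1_bE,
      homotopy1_bF, coneC_values, del3_bK, del3_bL, kj, ki, swap_mk, kk_values, ik_values,
      jk_values] <;>
    and_intros <;> abel

/-! ### Exactness -/

/-- If a homotopy contracts the complex at `N`, the complex is exact there. -/
lemma LinearMap.ker_eq_range_of_homotopy {R M N P : Type*} [Ring R] [AddCommGroup M]
    [AddCommGroup N] [AddCommGroup P] [Module R M] [Module R N] [Module R P]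
    {f : M →ₗ[R] N} {g : N →ₗ[R] P} (hgf : g ∘ₗ f = 0) (s : N →ₗ[R] M) (t : P →ₗ[R] N)
    (h : f ∘ₗ s + t ∘ₗ g = LinearMap.id) : LinearMap.ker g = LinearMap.range f := by
  refine le_antisymm (fun x hx => ⟨s x, ?_⟩) (LinearMap.range_le_ker_iff.2 hgf)
  simpa [LinearMap.mem_ker.1 hx] using LinearMap.congr_fun h x

lemma ker_augmentation : LinearMap.ker augmentation = LinearMap.range del1 :=
  LinearMap.ker_eq_range_of_homotopy augmentation_comp_del1 homotopy0
    (LinearMap.toSpanSingleton ℤ C0 (bA 0)) homotopy_degree_zero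

lemma augmentation_surjective : Function.Surjective augmentation := fun n =>
  ⟨n • bA 0, by simp [augmentation_bA]⟩

/-! ### Top-dimensional cycles -/

lemma del3_apply_G (x : C3) (p : DPair) :
    del3 x (Sum.inl p) = x (Sum.inl p) - x (Sum.inr p) := by
  refine LinearMap.congr_fun (f := Finsupp.lapply (Sum.inl p) ∘ₗ del3)
    (g := Finsupp.lapply (Sum.inl p) - Finsupp.lapply (Sum.inr p)) ?_ x
  apply C3.hom_ext <;> intro q <;>
    simp only [LinearMap.comp_apply, del3_bK, del3_bL] <;>
    simp [bG, bH, bI, bJ, bK, bL, Finsupp.single_apply]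

lemma del3_apply_H (x : C3) (p : DPair) :
    del3 x (Sum.inr (Sum.inl p)) = x (Sum.inl p.swap) - x (Sum.inl p) := by
  refine LinearMap.congr_fun (f := Finsupp.lapply (Sum.inr (Sum.inl p)) ∘ₗ del3)
    (g := Finsupp.lapply (Sum.inl p.swap) - Finsupp.lapply (Sum.inl p)) ?_ x
  apply C3.hom_ext <;> intro q <;>
    simp only [LinearMap.comp_apply, del3_bK, del3_bL] <;>
    simp [bG, bH, bI, bJ, bK, bL, Finsupp.single_apply, DPair.swap_eq_iff]
  abel

lemma del3_apply_J (x : C3) (p : DPair) :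
    del3 x (Sum.inr (Sum.inr (Sum.inr p.ki))) = x (Sum.inr p) - x (Sum.inl p.ki) := by
  refine LinearMap.congr_fun (f := Finsupp.lapply (Sum.inr (Sum.inr (Sum.inr p.ki))) ∘ₗ del3)
    (g := Finsupp.lapply (Sum.inr p) - Finsupp.lapply (Sum.inl p.ki)) ?_ x
  apply C3.hom_ext <;> intro q <;>
    simp only [LinearMap.comp_apply, del3_bK, del3_bL] <;>
    simp [bG, bH, bI, bJ, bK, bL, Finsupp.single_apply, ki_inj]

/-- The fundamental cycle, the sum of all `3`-cells. -/
noncomputable def fundamentalCycle : C3 := Finsupp.equivFunOnFinite.symm fun _ => 1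

lemma eq_smul_fundamentalCycle {x : C3} (hx : del3 x = 0) :
    x = x (Sum.inl (mk 0 1)) • fundamentalCycle := by
  have hG (p : DPair) : x (Sum.inr p) = x (Sum.inl p) := by
    have := del3_apply_G x p
    rw [hx, Finsupp.zero_apply] at this
    omega
  have hH (p : DPair) : x (Sum.inl p.swap) = x (Sum.inl p) := by
    have := del3_apply_H x p
    rw [hx, Finsupp.zero_apply] at this
    omega
  have hJ (p : DPair) : x (Sum.inl p.ki) = x (Sum.inl p) := by
    have := del3_apply_J x p
    rw [hx, Finsupp.zero_apply, hG] at this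
    omega
  have hK : ∀ p, x (Sum.inl p) = x (Sum.inl (mk 0 1)) := by
    have h₁ := hJ (mk 0 1)
    have h₂ := hJ (mk 2 0)
    have h₃ := hH (mk 0 1)
    have h₄ := hH (mk 1 2)
    have h₅ := hH (mk 2 0)
    simp only [ki, swap_mk, ik_values] at h₁ h₂ h₃ h₄ h₅
    rw [DPair.forall_iff]
    and_intros <;> omega
  ext (p | p) <;> simp [fundamentalCycle, hG, hK p]

lemma del3_fundamentalCycle : del3 fundamentalCycle = 0 := by
  have h : fundamentalCycle = ∑ p : DPair, (bK p + bL p) := by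
    ext (p | p) <;> simp [fundamentalCycle, bK, bL, Finsupp.single_apply]
  have hswap : ∀ f : DPair → C2, ∑ p : DPair, f p.swap = ∑ p, f p := fun f =>
    Function.Bijective.sum_comp (by decide) f
  have hki : ∀ f : DPair → C2, ∑ p : DPair, f p.ki = ∑ p, f p := fun f =>
    Function.Bijective.sum_comp (by decide) f
  simp only [h, map_sum, map_add, del3_bK, del3_bL, Finset.sum_add_distrib,
    Finset.sum_sub_distrib, hswap, hki]
  abel

lemma ker_del3_eq_span : LinearMap.ker del3 = ℤ ∙ fundamentalCycle := by
  refine le_antisymm (fun x hx => ?_) ?_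
  · rw [eq_smul_fundamentalCycle hx]
    exact Submodule.smul_mem _ _ (Submodule.mem_span_singleton_self _)
  · simpa using del3_fundamentalCycle

lemma fundamentalCycle_ne_zero : fundamentalCycle ≠ 0 := fun h => by
  simpa [fundamentalCycle] using DFunLike.congr_fun h (Sum.inl (mk 0 1))

/-- The cellular chain complex of Example 7 (the arc complex of the thrice
punctured monogon `F₀,₁³`) is a chain complex and has the homology of the
3-sphere: `H₀ ≅ ℤ`, `H₁ = H₂ = 0`, `H₃ ≅ ℤ`. -/
theorem arcComplex_thrice_punctured_monogon_homology :
    del1 ∘ₗ del2 = 0 ∧ del2 ∘ₗ del3 = 0 ∧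
    Nonempty ((C0 ⧸ LinearMap.range del1) ≃ₗ[ℤ] ℤ) ∧
    LinearMap.ker del1 = LinearMap.range del2 ∧
    LinearMap.ker del2 = LinearMap.range del3 ∧
    Nonempty (LinearMap.ker del3 ≃ₗ[ℤ] ℤ) := by
  exact ⟨del1_comp_del2, del2_comp_del3,
    ⟨(Submodule.quotEquivOfEq _ _ ker_augmentation.symm).trans
      (augmentation.quotKerEquivOfSurjective augmentation_surjective)⟩,
    LinearMap.ker_eq_range_of_homotopy del1_comp_del2 homotopy1 homotopy0 homotopy_degree_one,
    LinearMap.ker_eq_range_of_homotopy del2_comp_del3 homotopy2 homotopy1 homotopy_degree_two,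
    ⟨(LinearEquiv.ofEq _ _ ker_del3_eq_span).trans
      (LinearEquiv.toSpanNonzeroSingleton ℤ C3 _ fundamentalCycle_ne_zero).symm⟩⟩
end

section
/- Fix r with 1 ≤ r ≤ 3. Let X_r = {(m, t) ∈ ℝʳ × ℝʳ : mᵢ ≥ 0 for all i, m₁ + ⋯ + m_r = 1, and mᵢ = 0 implies tᵢ = 0 for all i}, with the subspace topology from ℝ²ʳ, and let ℤʳ act on X_r by n · (m, t) = (m, t') where t'ᵢ = tᵢ + nᵢ mᵢ. Then the quotient topological space X_r / ℤʳ, with the quotient topology, is homeomorphic to the Euclidean sphere of dimension 2r − 1. -/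
/-- The space `X_r` of Dehn–Thurston coordinates for the generalized pair of pants
with `r` boundary components: pairs `(m, t)` of intersection and twisting numbers
with `mᵢ ≥ 0`, `m₁ + ⋯ + m_r = 1`, and `mᵢ = 0 → tᵢ = 0`, with the subspace
topology from `ℝʳ × ℝʳ ≅ ℝ²ʳ`. -/
def DTSpace (r : ℕ) : Set ((Fin r → ℝ) × (Fin r → ℝ)) :=
  {p | (∀ i, 0 ≤ p.1 i) ∧ (∑ i, p.1 i) = 1 ∧ ∀ i, p.1 i = 0 → p.2 i = 0}

/-- The orbit relation of the `ℤʳ`-action `n · (m, t) = (m, t + n * m)` on `X_r`,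
given by the boundary Dehn twists. -/
def DTRel (r : ℕ) (p q : DTSpace r) : Prop :=
  ∃ n : Fin r → ℤ, p.val.1 = q.val.1 ∧
    ∀ i, q.val.2 i = p.val.2 i + (n i : ℝ) * p.val.1 i

/-- The point of `ℂ` with squared modulus `m` and argument `2πt / m`; it is `0` for `m = 0`. -/
noncomputable def twistPoint (m t : ℝ) : ℂ :=
  (√m : ℂ) * Complex.exp ((2 * Real.pi * (t / m) : ℝ) * Complex.I)

theorem norm_twistPoint (m t : ℝ) : ‖twistPoint m t‖ = √m := by
  rw [twistPoint, norm_mul, Complex.norm_exp_ofReal_mul_I, mul_one, Complex.norm_real,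
    Real.norm_of_nonneg (Real.sqrt_nonneg m)]

theorem twistPoint_add_int_mul (m t : ℝ) (n : ℤ) :
    twistPoint m (t + n * m) = twistPoint m t := by
  by_cases hm : m = 0
  · simp [twistPoint, hm]
  · unfold twistPoint
    congr 1
    refine Complex.exp_eq_exp_iff_exists_int.2 ⟨n, ?_⟩
    rw [add_div, mul_div_cancel_right₀ _ hm]
    push_cast
    ring

theorem exists_int_of_twistPoint_eq {m t t' : ℝ} (hm : 0 < m)
    (h : twistPoint m t = twistPoint m t') : ∃ n : ℤ, t' = t + n * m := by
  have hs : (√m : ℂ) ≠ 0 := by exact_mod_cast (Real.sqrt_pos.2 hm).ne'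
  obtain ⟨n, hn⟩ := Complex.exp_eq_exp_iff_exists_int.1 (mul_left_cancel₀ hs h.symm)
  refine ⟨n, ?_⟩
  have hn' : (((2 * Real.pi * (t' / m) : ℝ) : ℂ)) = ((2 * Real.pi * (t / m + n) : ℝ) : ℂ) := by
    apply mul_right_cancel₀ Complex.I_ne_zero
    rw [hn]
    push_cast
    ring
  have hq : t' / m = t / m + n :=
    mul_left_cancel₀ (by positivity) (Complex.ofReal_injective hn')
  field_simp at hq
  linarith

theorem twistPoint_norm_sq_arg (z : ℂ) :
    twistPoint (‖z‖ ^ 2) (‖z‖ ^ 2 * (z.arg / (2 * Real.pi))) = z := by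
  by_cases hz : z = 0
  · simp [twistPoint, hz]
  · have hz' : ‖z‖ ^ 2 ≠ 0 := by positivity
    have h : 2 * Real.pi * (z.arg / (2 * Real.pi)) = z.arg := by field_simp
    rw [twistPoint, mul_div_cancel_left₀ _ hz', h, Real.sqrt_sq (norm_nonneg z),
      Complex.norm_mul_exp_arg_mul_I]

theorem continuousAt_twistPoint {p : ℝ × ℝ} (hp : 0 ≤ p.1) :
    ContinuousAt (fun q : ℝ × ℝ => twistPoint q.1 q.2) p := by
  rcases hp.eq_or_lt with h0 | hpos
  · have hz : twistPoint p.1 p.2 = 0 := by simp [twistPoint, ← h0]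
    rw [ContinuousAt, hz, tendsto_zero_iff_norm_tendsto_zero]
    simp only [norm_twistPoint]
    have hc : Continuous fun q : ℝ × ℝ => √q.1 := by fun_prop
    simpa [← h0] using hc.tendsto p
  · have hne := hpos.ne'
    unfold twistPoint
    have hd : ContinuousAt (fun q : ℝ × ℝ => q.2 / q.1) p :=
      continuousAt_snd.div continuousAt_fst hne
    fun_prop

/-- The map from Dehn–Thurston coordinates to the unit sphere of `ℂʳ`. -/
noncomputable def DTSpace.toSphere (r : ℕ) (p : DTSpace r) :
    Metric.sphere (0 : EuclideanSpace ℂ (Fin r)) 1 :=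
  ⟨WithLp.toLp 2 fun i => twistPoint (p.val.1 i) (p.val.2 i), by
    obtain ⟨h0, h1, -⟩ := p.2
    rw [mem_sphere_zero_iff_norm, EuclideanSpace.norm_eq]
    simp only [norm_twistPoint, Real.sq_sqrt (h0 _), h1, Real.sqrt_one]⟩

theorem DTSpace.continuous_toSphere (r : ℕ) : Continuous (DTSpace.toSphere r) := by
  refine Continuous.subtype_mk ((PiLp.continuous_toLp 2 _).comp (continuous_pi fun i => ?_)) _
  refine continuous_iff_continuousAt.2 fun p => ?_
  exact (continuousAt_twistPoint (p := (p.val.1 i, p.val.2 i)) (p.2.1 i)).comp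
    (f := fun p : DTSpace r => (p.val.1 i, p.val.2 i)) (by fun_prop)

theorem DTSpace.toSphere_eq_of_rel {r : ℕ} {p q : DTSpace r} (h : DTRel r p q) :
    DTSpace.toSphere r p = DTSpace.toSphere r q := by
  obtain ⟨n, hm, ht⟩ := h
  ext i
  simp [DTSpace.toSphere, ← hm, ht, twistPoint_add_int_mul]

theorem DTSpace.rel_of_toSphere_eq {r : ℕ} {p q : DTSpace r}
    (h : DTSpace.toSphere r p = DTSpace.toSphere r q) : DTRel r p q := by
  have hc (i : Fin r) :
      twistPoint (p.val.1 i) (p.val.2 i) = twistPoint (q.val.1 i) (q.val.2 i) :=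
    congrArg (fun x : Metric.sphere (0 : EuclideanSpace ℂ (Fin r)) 1 => x.val i) h
  have hm (i : Fin r) : p.val.1 i = q.val.1 i := by
    have hn := congrArg norm (hc i)
    rwa [norm_twistPoint, norm_twistPoint, Real.sqrt_inj (p.2.1 i) (q.2.1 i)] at hn
  have hn (i : Fin r) : ∃ n : ℤ, q.val.2 i = p.val.2 i + n * p.val.1 i := by
    rcases (p.2.1 i).eq_or_lt with h0 | hpos
    · refine ⟨0, ?_⟩
      rw [p.2.2.2 i h0.symm, q.2.2.2 i (by rw [← hm i, ← h0])]
      simp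
    · exact exists_int_of_twistPoint_eq hpos (by rw [hc i, hm i])
  choose n hn using hn
  exact ⟨n, funext hm, hn⟩

theorem DTSpace.toSphere_surjective (r : ℕ) : Function.Surjective (DTSpace.toSphere r) := by
  intro z
  refine ⟨⟨(fun i => ‖z.val i‖ ^ 2, fun i => ‖z.val i‖ ^ 2 * ((z.val i).arg / (2 * Real.pi))),
    fun i => by positivity, ?_, fun i hi => ?_⟩, ?_⟩
  · have hz := mem_sphere_zero_iff_norm.1 z.2
    rw [← EuclideanSpace.norm_sq_eq, hz, one_pow]
  · simp only at hi ⊢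
    rw [hi, zero_mul]
  · ext i
    exact twistPoint_norm_sq_arg (z.val i)

theorem isCompact_twist_fundamentalDomain (r : ℕ) :
    IsCompact {p : (Fin r → ℝ) × (Fin r → ℝ) | 0 ≤ p.2 ∧ p.2 ≤ p.1 ∧ ∑ i, p.1 i = 1} := by
  refine (isCompact_Icc (a := (0 : (Fin r → ℝ) × (Fin r → ℝ))) (b := 1)).of_isClosed_subset
    ?_ fun p hp => ?_
  · exact (isClosed_le continuous_const continuous_snd).inter
      ((isClosed_le continuous_snd continuous_fst).inter
        (isClosed_eq (f := fun p : (Fin r → ℝ) × (Fin r → ℝ) => ∑ i, p.1 i)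
          (by fun_prop) continuous_const))
  · obtain ⟨h0, h1, hs⟩ := hp
    have hm : p.1 ≤ 1 := fun i => (Finset.single_le_sum (f := p.1)
      (fun j _ => (h0 j).trans (h1 j)) (Finset.mem_univ i)).trans_eq hs
    exact ⟨⟨h0.trans h1, h0⟩, hm, h1.trans hm⟩

instance compactSpace_quot_DTRel (r : ℕ) : CompactSpace (Quot (DTRel r)) := by
  have hK := isCompact_iff_compactSpace.1 (isCompact_twist_fundamentalDomain r)
  have hsub : {p : (Fin r → ℝ) × (Fin r → ℝ) | 0 ≤ p.2 ∧ p.2 ≤ p.1 ∧ ∑ i, p.1 i = 1}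
      ⊆ DTSpace r := fun p ⟨h0, h1, hs⟩ =>
    ⟨fun i => (h0 i).trans (h1 i), hs, fun i hi => le_antisymm (hi ▸ h1 i) (h0 i)⟩
  have hsurj : Function.Surjective (Quot.mk (DTRel r) ∘ Set.inclusion hsub) := by
    intro x
    induction x using Quot.ind with | mk p =>
    have hfract (i : Fin r) : p.val.1 i * Int.fract (p.val.2 i / p.val.1 i)
        = p.val.2 i + ((-⌊p.val.2 i / p.val.1 i⌋ : ℤ) : ℝ) * p.val.1 i := by
      by_cases hm : p.val.1 i = 0
      · simp [hm, p.2.2.2 i hm]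
      · rw [Int.fract]
        push_cast
        field_simp
        ring
    refine ⟨⟨(p.val.1, fun i => p.val.1 i * Int.fract (p.val.2 i / p.val.1 i)),
      fun i => mul_nonneg (p.2.1 i) (Int.fract_nonneg _),
      fun i => mul_le_of_le_one_right (p.2.1 i) (Int.fract_lt_one _).le, p.2.2.1⟩, ?_⟩
    exact (Quot.sound ⟨fun i => -⌊p.val.2 i / p.val.1 i⌋, rfl, hfract⟩).symm
  exact hsurj.compactSpace (continuous_quot_mk.comp (continuous_inclusion hsub))

/-- The quotient of `X_r` by the boundary twists is the unit sphere of `ℂʳ`. -/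
noncomputable def quotDTRelHomeomorphSphere (r : ℕ) :
    Quot (DTRel r) ≃ₜ Metric.sphere (0 : EuclideanSpace ℂ (Fin r)) 1 :=
  Continuous.homeoOfEquivCompactToT2
    (f := Equiv.ofBijective
      (Quot.lift (DTSpace.toSphere r) fun _ _ => DTSpace.toSphere_eq_of_rel)
      ⟨by
        rintro ⟨p⟩ ⟨q⟩ h
        exact Quot.sound (DTSpace.rel_of_toSphere_eq h),
      Quot.surjective_lift _ |>.2 (DTSpace.toSphere_surjective r)⟩)
    (continuous_quot_lift _ (DTSpace.continuous_toSphere r))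

/-- A linear isometry equivalence restricts to a homeomorphism of unit spheres. -/
def LinearIsometryEquiv.unitSphereHomeomorph {E F : Type*} [NormedAddCommGroup E]
    [NormedAddCommGroup F] [NormedSpace ℝ E] [NormedSpace ℝ F] (e : E ≃ₗᵢ[ℝ] F) :
    Metric.sphere (0 : E) 1 ≃ₜ Metric.sphere (0 : F) 1 :=
  e.toHomeomorph.subtype fun x => by simp

/-- Proposition B in coordinates: for `1 ≤ r ≤ 3`, the quotient of the
Dehn–Thurston coordinate space `X_r` by the `ℤʳ`-action of the boundary Dehn
twists — i.e. the arc complex of the generalized pair of pants `F₀,ᵣ^{3−r}` — is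
homeomorphic to the sphere of dimension `2r − 1`. -/
theorem arcComplex_generalized_pants_spherical (r : ℕ) (h1 : 1 ≤ r) (h3 : r ≤ 3) :
    Nonempty (Quot (DTRel r) ≃ₜ Metric.sphere (0 : EuclideanSpace ℝ (Fin (2 * r))) 1) := by
  have hdim : Module.finrank ℝ (EuclideanSpace ℂ (Fin r)) = 2 * r := by
    rw [← Module.finrank_mul_finrank ℝ ℂ, Complex.finrank_real_complex, finrank_euclideanSpace_fin]
  let e := ((stdOrthonormalBasis ℝ (EuclideanSpace ℂ (Fin r))).reindex (finCongr hdim)).repr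
  exact ⟨(quotDTRelHomeomorphSphere r).trans e.unitSphereHomeomorph⟩
end
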